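/- arXiv:1310.7352 — 3 statements merged into one kernel-verified Lean document; each statement's English description precedes it below -/
import Mathlib

section
/- Let E = (⊕_n ℓ²(n))_{ℓ¹}. Then the operator-norm closure of G_{ℓ¹}(E) is the unique maximal two-sided ideal of the Banach algebra L(E): it is a proper closed two-sided ideal, and every proper two-sided ideal of L(E) is contained in it. -/
open Filter Topology
open scoped ENNReal

noncomputable section

instance : Fact ((1:ℝ≥0∞) ≤ 1) := ⟨le_rfl⟩

/-- `ℓ¹`, the space of absolutely summable real sequences. -/
abbrev ellOne : Type := lp (fun _ : ℕ => ℝ) 1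

/-- `E = (⊕ₙ ℓ²(n))_{ℓ¹}`, the `ℓ¹`-direct sum of the finite-dimensional Euclidean spaces
`ℓ²(n) = (ℝ^n, ‖·‖₂)`, `n = 1, 2, …`. -/
abbrev E2Space : Type := lp (fun n : ℕ => EuclideanSpace ℝ (Fin (n + 1))) 1

/-- The operator-norm closure of `G_{ℓ¹}(E) = {S ∘ R : R ∈ L(E, ℓ¹), S ∈ L(ℓ¹, E)}`, the
set of operators on `E` factoring through `ℓ¹`. -/
def closGEllOne : Set (E2Space →L[ℝ] E2Space) :=
  closure {T : E2Space →L[ℝ] E2Space |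
    ∃ (R : E2Space →L[ℝ] ellOne) (S : ellOne →L[ℝ] E2Space), T = S.comp R}

open scoped BigOperators RealInnerProductSpace

/-- The sign `±1` encoded by a Boolean. -/
def boolSign (b : Bool) : ℝ := if b then 1 else -1

lemma boolSign_not (b : Bool) : boolSign (!b) = -boolSign b := by
  cases b <;> simp [boolSign]

lemma boolSign_mul_self (b : Bool) : boolSign b * boolSign b = 1 := by
  cases b <;> simp [boolSign]

lemma norm_boolSign (b : Bool) : ‖boolSign b‖ = 1 := by
  cases b <;> simp [boolSign]

section Rademacher

variable {ι α : Type*} {F : Type*} [NormedAddCommGroup F] [InnerProductSpace ℝ F]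

/-- The Rademacher sum `∑ ± hₐ`, with the sign of the `a`-th term read off at the index `e a`. -/
def radSum (e : α → ι) (ω : ι → Bool) (S : Finset α) (h : α → F) : F :=
  ∑ a ∈ S, boolSign (ω (e a)) • h a

lemma map_radSum {G : Type*} [NormedAddCommGroup G] [InnerProductSpace ℝ G] (L : F →L[ℝ] G)
    (e : α → ι) (ω : ι → Bool) (S : Finset α) (h : α → F) :
    L (radSum e ω S h) = radSum e ω S fun a => L (h a) := by
  simp [radSum, map_sum]

variable [DecidableEq ι]

/-- Switching the sign at one index. -/
def flipAt (i : ι) (ω : ι → Bool) : ι → Bool := Function.update ω i (!ω i)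

lemma flipAt_self (i : ι) (ω : ι → Bool) : flipAt i ω i = !ω i := by simp [flipAt]

lemma flipAt_ne {i j : ι} (h : j ≠ i) (ω : ι → Bool) : flipAt i ω j = ω j := by
  simp [flipAt, h]

lemma flipAt_involutive (i : ι) : Function.Involutive (flipAt i) := by
  intro ω
  ext j
  by_cases h : j = i
  · subst h; simp [flipAt_self]
  · simp [flipAt_ne h]

lemma expect_eq_zero_of_flipAt [Fintype ι] (i : ι) (φ : (ι → Bool) → ℝ)
    (h : ∀ ω, φ (flipAt i ω) = -φ ω) : Finset.expect Finset.univ φ = 0 := by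
  have h1 : Finset.expect Finset.univ (fun ω => φ (flipAt i ω)) = Finset.expect Finset.univ φ :=
    Fintype.expect_equiv (flipAt_involutive i).toPerm _ _ fun ω => rfl
  simp only [h, Finset.expect_neg_distrib] at h1
  linarith

lemma radSum_flipAt (e : α → ι) {i : ι} {S : Finset α} (hi : ∀ a ∈ S, e a ≠ i)
    (ω : ι → Bool) (h : α → F) : radSum e (flipAt i ω) S h = radSum e ω S h :=
  Finset.sum_congr rfl fun a ha => by rw [flipAt_ne (hi a ha)]

variable [Fintype ι]

lemma expect_norm_sq_radSum [DecidableEq α] {e : α → ι} (he : Function.Injective e)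
    (b : (ι → Bool) → α → F) (hb : ∀ a a' ω, b (flipAt (e a) ω) a' = b ω a') (S : Finset α) :
    Finset.expect Finset.univ (fun ω => ‖radSum e ω S (b ω)‖ ^ 2) =
      ∑ a ∈ S, Finset.expect Finset.univ fun ω => ‖b ω a‖ ^ 2 := by
  induction S using Finset.induction_on with
  | empty => simp [radSum]
  | insert a S ha ih =>
    have key : ∀ ω, ‖radSum e ω (insert a S) (b ω)‖ ^ 2 = ‖b ω a‖ ^ 2 +
        ‖radSum e ω S (b ω)‖ ^ 2 + 2 * (boolSign (ω (e a)) * ⟪b ω a, radSum e ω S (b ω)⟫) := by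
      intro ω
      rw [radSum, Finset.sum_insert ha, ← radSum, norm_add_sq_real, norm_smul, norm_boolSign,
        one_mul, real_inner_smul_left]
      ring
    have hz : Finset.expect Finset.univ
        (fun ω => boolSign (ω (e a)) * ⟪b ω a, radSum e ω S (b ω)⟫) = 0 := by
      apply expect_eq_zero_of_flipAt (e a)
      intro ω
      have h2 : b (flipAt (e a) ω) = b ω := funext fun a' => hb a a' ω
      rw [flipAt_self, boolSign_not, h2, radSum_flipAt, neg_mul]
      intro a' ha' h
      exact ha (he h ▸ ha')
    simp only [key, Finset.expect_add_distrib, ← Finset.mul_expect, hz]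
    rw [Finset.sum_insert ha, ih]
    ring

lemma expect_norm_sq_radSum_const [DecidableEq α] {e : α → ι} (he : Function.Injective e)
    (h : α → F) (S : Finset α) :
    Finset.expect Finset.univ (fun ω => ‖radSum e ω S h‖ ^ 2) = ∑ a ∈ S, ‖h a‖ ^ 2 := by
  rw [expect_norm_sq_radSum he (fun _ => h) (fun _ _ _ => rfl)]
  simp

lemma expect_inner_radSum_sq [DecidableEq α] {e : α → ι} (he : Function.Injective e)
    (h : α → F) (S : Finset α) (y : (ι → Bool) → F) (hy : ∀ a ω, y (flipAt (e a) ω) = y ω) :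
    Finset.expect Finset.univ (fun ω => ⟪radSum e ω S h, y ω⟫ ^ 2) =
      Finset.expect Finset.univ fun ω => ∑ a ∈ S, ⟪h a, y ω⟫ ^ 2 := by
  have := expect_norm_sq_radSum he (fun ω a => ⟪h a, y ω⟫) (fun a a' ω => by rw [hy]) S
  simp only [Real.norm_eq_abs, sq_abs] at this
  rw [Finset.expect_sum_comm, ← this]
  refine Finset.expect_congr rfl fun ω _ => ?_
  simp [radSum, sum_inner, real_inner_smul_left]

lemma expect_norm_sq_sub_sq_radSum [DecidableEq α] {e : α → ι} (he : Function.Injective e)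
    (h : α → F) (S : Finset α) :
    Finset.expect Finset.univ
        (fun ω => (‖radSum e ω S h‖ ^ 2 - ∑ a ∈ S, ‖h a‖ ^ 2) ^ 2) ≤
      2 * ∑ a ∈ S, ∑ b ∈ S, ⟪h a, h b⟫ ^ 2 := by
  induction S using Finset.induction_on with
  | empty => simp [radSum]
  | insert a S ha ih =>
    set X : (ι → Bool) → ℝ := fun ω => ‖radSum e ω S h‖ ^ 2 - ∑ a ∈ S, ‖h a‖ ^ 2 with hX
    set Y : (ι → Bool) → ℝ := fun ω => ⟪radSum e ω S h, h a⟫ with hY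
    have hinv : ∀ ω, radSum e (flipAt (e a) ω) S h = radSum e ω S h := fun ω =>
      radSum_flipAt e (fun a' ha' heq => ha (by rwa [← he heq])) ω h
    have key : ∀ ω, (‖radSum e ω (insert a S) h‖ ^ 2 - ∑ a ∈ insert a S, ‖h a‖ ^ 2) ^ 2 =
        X ω ^ 2 + 4 * Y ω ^ 2 + 4 * (boolSign (ω (e a)) * (X ω * Y ω)) := by
      intro ω
      rw [radSum, Finset.sum_insert ha, ← radSum, Finset.sum_insert ha, norm_add_sq_real,
        norm_smul, norm_boolSign, one_mul, real_inner_smul_left, real_inner_comm]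
      have := boolSign_mul_self (ω (e a))
      linear_combination 4 * Y ω ^ 2 * this
    have hz : Finset.expect Finset.univ (fun ω => boolSign (ω (e a)) * (X ω * Y ω)) = 0 := by
      apply expect_eq_zero_of_flipAt (e a)
      intro ω
      rw [flipAt_self, boolSign_not]
      simp only [hX, hY, hinv, neg_mul]
    have hYY := expect_inner_radSum_sq he h S (fun _ => h a) (fun _ _ => rfl)
    rw [Fintype.expect_const] at hYY
    simp only [key, Finset.expect_add_distrib, ← Finset.mul_expect, hz]
    have hs : ∑ x ∈ insert a S, ∑ b ∈ insert a S, ⟪h x, h b⟫ ^ 2 =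
        (⟪h a, h a⟫ ^ 2 + ∑ b ∈ S, ⟪h b, h a⟫ ^ 2) +
          (∑ b ∈ S, ⟪h b, h a⟫ ^ 2 + ∑ x ∈ S, ∑ b ∈ S, ⟪h x, h b⟫ ^ 2) := by
      simp only [Finset.sum_insert ha, Finset.sum_add_distrib]
      simp only [real_inner_comm (h a)]
    rw [hs]
    have : Finset.expect Finset.univ (fun ω => Y ω ^ 2) = ∑ b ∈ S, ⟪h b, h a⟫ ^ 2 := hYY
    rw [this]
    nlinarith [sq_nonneg ⟪h a, h a⟫]

/-- The `L¹`-Khinchine inequality for Hilbert-space valued Rademacher sums. -/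
lemma sqrt_sum_le_expect_norm_radSum [DecidableEq α] {e : α → ι} (he : Function.Injective e)
    (h : α → F) (S : Finset α) :
    √(∑ a ∈ S, ‖h a‖ ^ 2) ≤ 2 * Finset.expect Finset.univ fun ω => ‖radSum e ω S h‖ := by
  set v := √(∑ a ∈ S, ‖h a‖ ^ 2) with hv
  have hv2 : v ^ 2 = ∑ a ∈ S, ‖h a‖ ^ 2 := Real.sq_sqrt (by positivity)
  rcases (Real.sqrt_nonneg (∑ a ∈ S, ‖h a‖ ^ 2)).eq_or_lt with h0 | hpos
  · rw [← hv] at h0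
    rw [← h0]
    exact mul_nonneg zero_le_two (Finset.expect_nonneg fun _ _ => norm_nonneg _)
  rw [← hv] at hpos
  have h2 := expect_norm_sq_radSum_const he h S
  have h4 := expect_norm_sq_sub_sq_radSum he h S
  have hcs : ∑ a ∈ S, ∑ b ∈ S, ⟪h a, h b⟫ ^ 2 ≤ v ^ 4 := by
    rw [show v ^ 4 = v ^ 2 * v ^ 2 by ring, hv2, Finset.sum_mul_sum]
    refine Finset.sum_le_sum fun a _ => Finset.sum_le_sum fun b _ => ?_
    rw [← mul_pow, ← sq_abs]
    exact pow_le_pow_left₀ (abs_nonneg _) (abs_real_inner_le_norm _ _) 2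
  rw [← hv2] at h2 h4
  have hpt : ∀ ω, 11 / 16 * v ^ 4 - (1 / 16) * (‖radSum e ω S h‖ ^ 2 - v ^ 2) ^ 2
      + (5 / 8) * v ^ 2 * (‖radSum e ω S h‖ ^ 2 - v ^ 2) ≤ v ^ 3 * ‖radSum e ω S h‖ := by
    intro ω
    set t := ‖radSum e ω S h‖
    have : 0 ≤ t * (t - 2 * v) ^ 2 * (t + 4 * v) := by positivity
    nlinarith
  have hE := Finset.expect_le_expect (s := Finset.univ) fun ω _ => hpt ω
  simp only [Finset.expect_add_distrib, Finset.expect_sub_distrib, ← Finset.mul_expect, h2,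
    Fintype.expect_const] at hE
  have : v ^ 3 * (v / 2) ≤ v ^ 3 * Finset.expect Finset.univ fun ω => ‖radSum e ω S h‖ := by
    nlinarith
  have := le_of_mul_le_mul_left this (by positivity)
  linarith

end Rademacher

section Gram

variable {F : Type*} [NormedAddCommGroup F] [InnerProductSpace ℝ F]
variable {κ α : Type*} [Fintype α]

/-- The Rademacher sum formed with the `j`-th column of a matrix of signs. -/
def radCol (h : α → F) (ω : α × κ → Bool) (j : κ) : F :=
  radSum (fun a => (a, j)) ω Finset.univ h

lemma map_radCol {G : Type*} [NormedAddCommGroup G] [InnerProductSpace ℝ G] (L : F →L[ℝ] G)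
    (ω : α × κ → Bool) (h : α → F) (j : κ) :
    L (radCol h ω j) = radCol (fun a => L (h a)) ω j :=
  map_radSum L _ _ _ _

variable [Fintype κ] [DecidableEq κ]

/-- The squared Hilbert–Schmidt distance between the Gram matrix of `u` and `v • 1`. -/
def gramDev (v : ℝ) (u : κ → F) : ℝ :=
  ∑ j, ∑ l, (⟪u j, u l⟫ - if j = l then v else 0) ^ 2

lemma gramDev_nonneg (v : ℝ) (u : κ → F) : 0 ≤ gramDev v u := by
  unfold gramDev; positivity

lemma abs_norm_sq_sum_smul_sub_le {v t : ℝ} (ht : 0 ≤ t) {u : κ → F} (hu : gramDev v u ≤ t ^ 2)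
    (c : EuclideanSpace ℝ κ) :
    |‖∑ j, c j • u j‖ ^ 2 - v * ‖c‖ ^ 2| ≤ t * ‖c‖ ^ 2 := by
  have hc : ‖c‖ ^ 2 = ∑ j, c j ^ 2 := by simp [EuclideanSpace.norm_sq_eq]
  have h1 : ‖∑ j, c j • u j‖ ^ 2 - v * ‖c‖ ^ 2 =
      ∑ p : κ × κ, (c p.1 * c p.2) * (⟪u p.1, u p.2⟫ - if p.1 = p.2 then v else 0) := by
    rw [Fintype.sum_prod_type, ← real_inner_self_eq_norm_sq, sum_inner, hc]
    simp only [inner_sum, real_inner_smul_left, real_inner_smul_right, mul_sub,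
      Finset.sum_sub_distrib, mul_ite, mul_zero, Finset.sum_ite_eq, Finset.mem_univ, if_true]
    rw [Finset.mul_sum]
    congr 1
    · exact Finset.sum_congr rfl fun _ _ => Finset.sum_congr rfl fun _ _ => by ring
    · exact Finset.sum_congr rfl fun _ _ => by ring
  have h2 : ∑ p : κ × κ, (c p.1 * c p.2) ^ 2 = (‖c‖ ^ 2) ^ 2 := by
    rw [Fintype.sum_prod_type, hc, sq (∑ j, c j ^ 2), Finset.sum_mul_sum]
    simp only [mul_pow]
  have h3 : ∑ p : κ × κ, (⟪u p.1, u p.2⟫ - if p.1 = p.2 then v else 0) ^ 2 = gramDev v u := by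
    rw [Fintype.sum_prod_type]; rfl
  apply abs_le_of_sq_le_sq _ (by positivity)
  rw [h1]
  refine (Finset.sum_mul_sq_le_sq_mul_sq _ _ _).trans ?_
  rw [h2, h3, mul_pow, mul_comm]
  gcongr

variable [DecidableEq α]

lemma expect_gramDev_radCol_le {h : α → F} {θ : ℝ}
    (hθ : ∀ y, ∑ a, ⟪h a, y⟫ ^ 2 ≤ θ * ‖y‖ ^ 2) :
    Finset.expect Finset.univ
        (fun ω : α × κ → Bool => gramDev (∑ a, ‖h a‖ ^ 2) (radCol h ω)) ≤
      2 * (Fintype.card κ : ℝ) ^ 2 * (θ * ∑ a, ‖h a‖ ^ 2) := by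
  have hinj : ∀ j : κ, Function.Injective fun a : α => (a, j) := fun j a b hab => by
    simpa using hab
  have hθh : ∑ b, ∑ a, ⟪h a, h b⟫ ^ 2 ≤ θ * ∑ a, ‖h a‖ ^ 2 := by
    rw [Finset.mul_sum]
    exact Finset.sum_le_sum fun b _ => hθ (h b)
  have h0 : 0 ≤ θ * ∑ a, ‖h a‖ ^ 2 := le_trans (by positivity) hθh
  have key : ∀ j l : κ, Finset.expect Finset.univ (fun ω : α × κ → Bool =>
      (⟪radCol h ω j, radCol h ω l⟫ - if j = l then ∑ a, ‖h a‖ ^ 2 else 0) ^ 2) ≤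
      2 * (θ * ∑ a, ‖h a‖ ^ 2) := by
    intro j l
    by_cases hjl : j = l
    · subst hjl
      simp only [if_true, real_inner_self_eq_norm_sq]
      refine (expect_norm_sq_sub_sq_radSum (hinj j) h Finset.univ).trans ?_
      rw [Finset.sum_comm]
      linarith
    · simp only [hjl, if_false, sub_zero]
      have h1 := expect_inner_radSum_sq (hinj j) h Finset.univ (fun ω => radCol h ω l) (by
        intro a ω
        refine radSum_flipAt _ (fun a' _ heq => hjl ?_) _ _
        simpa using (congrArg Prod.snd heq).symm)
      change Finset.expect Finset.univ (fun ω : α × κ → Bool =>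
        ⟪radSum (fun a => (a, j)) ω Finset.univ h, radCol h ω l⟫ ^ 2) ≤ _
      rw [h1]
      refine (Finset.expect_le_expect fun ω _ => hθ (radCol h ω l)).trans ?_
      rw [← Finset.mul_expect]
      have h2 := expect_norm_sq_radSum_const (hinj l) h Finset.univ
      change θ * Finset.expect Finset.univ (fun ω : α × κ → Bool =>
        ‖radSum (fun a => (a, l)) ω Finset.univ h‖ ^ 2) ≤ _
      rw [h2]
      linarith
  simp only [gramDev, Finset.expect_sum_comm]
  refine (Finset.sum_le_sum fun j _ => Finset.sum_le_sum fun l _ => key j l).trans ?_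
  simp only [Finset.sum_const, Finset.card_univ, nsmul_eq_mul]
  apply le_of_eq
  ring

end Gram

section Compression

variable {F : Type*} [NormedAddCommGroup F] [InnerProductSpace ℝ F]

/-- Removing boundedly many directions from a finite family of vectors makes it flat. -/
lemma exists_orthonormal_flat {α : Type*} [Fintype α] (a : α → F) {L : ℕ} (hL : 0 < L) :
    ∃ Y : Finset F, Orthonormal ℝ (fun y : Y => (y : F)) ∧ Y.card ≤ L ∧
      ∀ w : F, (∀ y ∈ Y, ⟪y, w⟫ = 0) →
        ∑ i, ⟪a i, w⟫ ^ 2 ≤ (∑ i, ‖a i‖ ^ 2) / L * ‖w‖ ^ 2 := by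
  classical
  set σ := ∑ i, ‖a i‖ ^ 2
  have hLp : (0 : ℝ) < L := by exact_mod_cast hL
  set P : Finset F → Prop := fun Y => Orthonormal ℝ (fun y : Y => (y : F)) ∧
    ∀ y ∈ Y, σ / L < ∑ i, ⟪a i, y⟫ ^ 2 with hP
  have hcard : ∀ Y, P Y → Y.card ≤ L := by
    intro Y ⟨hY, hY2⟩
    rcases Y.eq_empty_or_nonempty with rfl | hne
    · simp
    have h1 : ∑ y ∈ Y, ∑ i, ⟪a i, y⟫ ^ 2 ≤ σ := by
      rw [Finset.sum_comm]
      refine Finset.sum_le_sum fun i _ => ?_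
      have := hY.sum_inner_products_le (a i) (s := Finset.univ)
      rw [← Finset.sum_coe_sort Y]
      refine le_trans (le_of_eq (Finset.sum_congr rfl fun y _ => ?_)) this
      rw [Real.norm_eq_abs, sq_abs, real_inner_comm]
    have h2 : ∑ y ∈ Y, σ / L < ∑ y ∈ Y, ∑ i, ⟪a i, y⟫ ^ 2 := Finset.sum_lt_sum_of_nonempty hne hY2
    rw [Finset.sum_const, nsmul_eq_mul] at h2
    have h3 := h2.trans_le h1
    rw [← mul_div_assoc, div_lt_iff₀ hLp] at h3
    have hσ0 : 0 ≤ σ := by positivity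
    by_contra hlt
    push Not at hlt
    have : (L : ℝ) ≤ Y.card := by exact_mod_cast hlt.le
    nlinarith
  have hex : ∃ n, ∃ Y, P Y ∧ L - Y.card = n := ⟨_, ∅, ⟨by simp [Orthonormal], by simp⟩, rfl⟩
  obtain ⟨Y, hY, hn⟩ := Nat.find_spec hex
  have hmin : ∀ Y', P Y' → Y'.card ≤ Y.card := by
    intro Y' hY'
    have h1 := Nat.find_min' hex ⟨Y', hY', rfl⟩
    rw [← hn] at h1
    have := hcard Y hY
    have := hcard Y' hY'
    omega
  refine ⟨Y, hY.1, hcard Y hY, fun w hw => ?_⟩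
  by_contra hlt
  push Not at hlt
  have hw0 : w ≠ 0 := by
    rintro rfl
    simp at hlt
  have hwn : 0 < ‖w‖ := norm_pos_iff.2 hw0
  set y₀ : F := ‖w‖⁻¹ • w with hy₀
  have hy₀n : ‖y₀‖ = 1 := by rw [hy₀, norm_smul, norm_inv, norm_norm, inv_mul_cancel₀ hwn.ne']
  have hy₀o : ∀ y ∈ Y, ⟪y, y₀⟫ = 0 := fun y hy => by
    rw [hy₀, real_inner_smul_right, hw y hy, mul_zero]
  have hy₀Y : y₀ ∉ Y := fun hmem => by
    have := hy₀o y₀ hmem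
    rw [real_inner_self_eq_norm_sq, hy₀n] at this
    norm_num at this
  have hPY : P (insert y₀ Y) := by
    refine ⟨⟨?_, ?_⟩, ?_⟩
    · rintro ⟨y, hy⟩
      rcases Finset.mem_insert.1 hy with rfl | hy
      · exact hy₀n
      · exact hY.1.1 ⟨y, hy⟩
    · rintro ⟨y, hy⟩ ⟨z, hz⟩ hyz
      have hyz' : y ≠ z := fun h => hyz (Subtype.ext h)
      change ⟪y, z⟫ = 0
      rcases Finset.mem_insert.1 hy with rfl | hy <;> rcases Finset.mem_insert.1 hz with rfl | hz
      · exact absurd rfl hyz'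
      · rw [real_inner_comm]; exact hy₀o z hz
      · exact hy₀o y hy
      · exact hY.1.2 (i := ⟨y, hy⟩) (j := ⟨z, hz⟩) (fun h => hyz' (congrArg Subtype.val h))
    · intro y hy
      rcases Finset.mem_insert.1 hy with rfl | hy
      · simp only [hy₀, real_inner_smul_right, mul_pow]
        rw [← Finset.mul_sum, inv_pow, ← div_eq_inv_mul, lt_div_iff₀ (by positivity)]
        exact hlt
      · exact hY.2 y hy
  have := hmin _ hPY
  rw [Finset.card_insert_of_notMem hy₀Y] at this
  omega

/-- The orthogonal projection onto the span of an orthonormal finite set. -/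
def finsetProj (Y : Finset F) : F →L[ℝ] F :=
  ∑ y ∈ Y, (innerSL ℝ y).smulRight y

lemma finsetProj_apply (Y : Finset F) (x : F) : finsetProj Y x = ∑ y ∈ Y, ⟪y, x⟫ • y := by
  simp [finsetProj]

lemma inner_finsetProj {Y : Finset F} (hY : Orthonormal ℝ (fun y : Y => (y : F))) {y : F}
    (hy : y ∈ Y) (x : F) : ⟪y, finsetProj Y x⟫ = ⟪y, x⟫ := by
  classical
  rw [finsetProj_apply, inner_sum, Finset.sum_eq_single y]
  · rw [real_inner_smul_right, real_inner_self_eq_norm_sq, hY.1 ⟨y, hy⟩]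
    simp
  · intro z hz hzy
    have : ⟪y, z⟫ = 0 := hY.2 (i := ⟨y, hy⟩) (j := ⟨z, hz⟩) fun h => hzy (congrArg Subtype.val h).symm
    rw [real_inner_smul_right, this, mul_zero]
  · exact fun h => absurd hy h

lemma inner_sub_finsetProj {Y : Finset F} (hY : Orthonormal ℝ (fun y : Y => (y : F))) {y : F}
    (hy : y ∈ Y) (x : F) : ⟪y, x - finsetProj Y x⟫ = 0 := by
  rw [inner_sub_right, inner_finsetProj hY hy, sub_self]

lemma inner_sub_finsetProj_sub {Y : Finset F} (hY : Orthonormal ℝ (fun y : Y => (y : F)))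
    (x w : F) : ⟪x - finsetProj Y x, w - finsetProj Y w⟫ = ⟪x - finsetProj Y x, w⟫ := by
  rw [inner_sub_right, sub_eq_self, finsetProj_apply Y w, inner_sum]
  refine Finset.sum_eq_zero fun y hy => ?_
  rw [real_inner_smul_right, real_inner_comm y (x - finsetProj Y x), inner_sub_finsetProj hY hy,
    mul_zero]

lemma norm_sub_finsetProj_le {Y : Finset F} (hY : Orthonormal ℝ (fun y : Y => (y : F))) (x : F) :
    ‖x - finsetProj Y x‖ ≤ ‖x‖ := by
  have h := inner_sub_finsetProj_sub hY x x
  rw [real_inner_self_eq_norm_sq] at h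
  have := real_inner_le_norm (x - finsetProj Y x) x
  rw [← h] at this
  by_contra hlt
  push Not at hlt
  nlinarith [norm_nonneg x]

lemma inner_sub_finsetProj_comm {Y : Finset F} (hY : Orthonormal ℝ (fun y : Y => (y : F)))
    (x w : F) : ⟪x - finsetProj Y x, w⟫ = ⟪x, w - finsetProj Y w⟫ := by
  rw [← inner_sub_finsetProj_sub hY, real_inner_comm, inner_sub_finsetProj_sub hY, real_inner_comm]

/-- The compressed family is flat in every direction. -/
lemma exists_flat_compression {α : Type*} [Fintype α] (a : α → F) {L : ℕ} (hL : 0 < L) :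
    ∃ Y : Finset F, Orthonormal ℝ (fun y : Y => (y : F)) ∧ Y.card ≤ L ∧
      ∀ w : F, ∑ i, ⟪a i - finsetProj Y (a i), w⟫ ^ 2 ≤ (∑ i, ‖a i‖ ^ 2) / L * ‖w‖ ^ 2 := by
  obtain ⟨Y, hY, hc, h⟩ := exists_orthonormal_flat a hL
  refine ⟨Y, hY, hc, fun w => ?_⟩
  simp only [inner_sub_finsetProj_comm hY]
  refine (h _ fun y hy => inner_sub_finsetProj hY hy w).trans ?_
  gcongr
  exact norm_sub_finsetProj_le hY w

end Compression

section LpOne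

variable {ι : Type*} {F : ι → Type*} [∀ i, NormedAddCommGroup (F i)]

lemma lpOne_hasSum_norm (f : lp F 1) : HasSum (fun i => ‖f i‖) ‖f‖ := by
  simpa using lp.hasSum_norm (p := 1) (by simp) f

lemma lpOne_sum_norm_le (f : lp F 1) (s : Finset ι) : ∑ i ∈ s, ‖f i‖ ≤ ‖f‖ := by
  exact sum_le_hasSum s (fun _ _ => norm_nonneg _) (lpOne_hasSum_norm f)

variable [∀ i, NormedSpace ℝ (F i)]
variable {X Y : Type*} [NormedAddCommGroup X] [NormedSpace ℝ X]
  [NormedAddCommGroup Y] [NormedSpace ℝ Y]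

/-- The operator into an `ℓ¹`-sum with given coordinates. -/
def lpOneMk (R : ∀ i, X →L[ℝ] F i) (K : ℝ)
    (h : ∀ x (s : Finset ι), ∑ i ∈ s, ‖R i x‖ ≤ K * ‖x‖) : X →L[ℝ] lp F 1 :=
  LinearMap.mkContinuous
    { toFun := fun x => ⟨fun i => R i x, memℓp_gen' (C := K * ‖x‖) (by simpa using h x)⟩
      map_add' := fun x y => by ext i; exact map_add (R i) x y
      map_smul' := fun c x => by ext i; exact map_smul (R i) c x } K
    fun x => lp.norm_le_of_forall_sum_le (by simp) (by simpa using h x ∅)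
      (by simpa using h x)

lemma lpOneMk_apply (R : ∀ i, X →L[ℝ] F i) (K : ℝ)
    (h : ∀ x (s : Finset ι), ∑ i ∈ s, ‖R i x‖ ≤ K * ‖x‖) (x : X) (i : ι) :
    lpOneMk R K h x i = R i x := rfl

lemma norm_lpOneMk_le (R : ∀ i, X →L[ℝ] F i) (K : ℝ)
    (h : ∀ x (s : Finset ι), ∑ i ∈ s, ‖R i x‖ ≤ K * ‖x‖) (x : X) :
    ‖lpOneMk R K h x‖ ≤ K * ‖x‖ :=
  lp.norm_le_of_forall_sum_le (by simp) (by simpa using h x ∅) (by simpa [lpOneMk_apply] using h x)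

lemma norm_le_of_single [DecidableEq ι] {V : lp F 1 →L[ℝ] Y} {C : ℝ}
    (h : ∀ i x, ‖V (lp.single 1 i x)‖ ≤ C * ‖x‖) (f : lp F 1) : ‖V f‖ ≤ C * ‖f‖ := by
  have h1 : HasSum (fun i => V (lp.single 1 i (f i))) (V f) :=
    (lp.hasSum_single (by simp) f).mapL V
  have h2 : HasSum (fun i => C * ‖f i‖) (C * ‖f‖) := (lpOne_hasSum_norm f).mul_left C
  rw [← h1.tsum_eq]
  exact tsum_of_norm_bounded h2 fun i => h i (f i)

variable [CompleteSpace Y]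

lemma lpOneSum_summable (S : ∀ i, F i →L[ℝ] Y) (C : ℝ) (h : ∀ i x, ‖S i x‖ ≤ C * ‖x‖)
    (f : lp F 1) : Summable fun i => S i (f i) :=
  Summable.of_norm_bounded ((lpOne_hasSum_norm f).summable.mul_left C) fun i => h i (f i)

/-- The operator on an `ℓ¹`-sum with given restrictions to the summands. -/
def lpOneSum (S : ∀ i, F i →L[ℝ] Y) (C : ℝ) (h : ∀ i x, ‖S i x‖ ≤ C * ‖x‖) : lp F 1 →L[ℝ] Y :=
  LinearMap.mkContinuous
    { toFun := fun f => ∑' i, S i (f i)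
      map_add' := fun f g => by
        simp only [lp.coeFn_add, Pi.add_apply, map_add]
        exact (lpOneSum_summable S C h f).tsum_add (lpOneSum_summable S C h g)
      map_smul' := fun c f => by
        simp only [lp.coeFn_smul, Pi.smul_apply, map_smul, RingHom.id_apply]
        exact (lpOneSum_summable S C h f).tsum_const_smul c } C
    fun f => tsum_of_norm_bounded ((lpOne_hasSum_norm f).mul_left C) fun i => h i (f i)

lemma lpOneSum_hasSum (S : ∀ i, F i →L[ℝ] Y) (C : ℝ) (h : ∀ i x, ‖S i x‖ ≤ C * ‖x‖)
    (f : lp F 1) : HasSum (fun i => S i (f i)) (lpOneSum S C h f) :=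
  (lpOneSum_summable S C h f).hasSum

lemma lpOneSum_single [DecidableEq ι] (S : ∀ i, F i →L[ℝ] Y) (C : ℝ)
    (h : ∀ i x, ‖S i x‖ ≤ C * ‖x‖) (i : ι) (x : F i) :
    lpOneSum S C h (lp.single 1 i x) = S i x := by
  refine (lpOneSum_hasSum S C h _).unique ?_
  convert hasSum_single i ?_ using 1
  · rw [lp.single_apply_self]
  · intro j hj
    rw [lp.single_apply_ne _ _ _ hj, map_zero]

end LpOne

section Factor

variable {X Y : Type*} [NormedAddCommGroup X] [NormedSpace ℝ X]
  [NormedAddCommGroup Y] [NormedSpace ℝ Y]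

/-- `U` is an absolutely convergent series of rank-one operators indexed by `ι`, which amounts to
a factorization of `U` through `ℓ¹(ι)` with constant `K`. -/
def EllOneSeries (ι : Type*) (K : ℝ) (U : X →L[ℝ] Y) : Prop :=
  ∃ (r : ι → X →L[ℝ] ℝ) (s : ι → Y), (∀ i, ‖s i‖ ≤ 1) ∧
    (∀ x (t : Finset ι), ∑ i ∈ t, ‖r i x‖ ≤ K * ‖x‖) ∧ ∀ x, HasSum (fun i => r i x • s i) (U x)

lemma EllOneSeries.toNat {ι : Type*} [Countable ι] {K : ℝ} {U : X →L[ℝ] Y}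
    (h : EllOneSeries ι K U) : EllOneSeries ℕ K U := by
  classical
  obtain ⟨r, s, hs, hr, hU⟩ := h
  obtain ⟨e, he⟩ := exists_injective_nat ι
  have hex : ∀ i, Function.extend e r 0 (e i) = r i := fun i => he.extend_apply _ _ _
  refine ⟨Function.extend e r 0, Function.extend e s 0, ?_, ?_, fun x => ?_⟩
  · intro n
    by_cases hn : ∃ i, e i = n
    · obtain ⟨i, rfl⟩ := hn
      rw [he.extend_apply]
      exact hs i
    · rw [Function.extend_apply' _ _ _ hn]
      simp
  · intro x t
    refine le_trans (le_of_eq ?_) (hr x (t.preimage e he.injOn))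
    rw [← Finset.sum_preimage e t he.injOn (fun n => ‖Function.extend e r 0 n x‖)]
    · simp only [hex]
    · intro n _ hn
      rw [Function.extend_apply' _ _ _ (by simpa using hn)]
      simp
  · refine (he.hasSum_iff ?_).1 ?_
    · intro n hn
      rw [Function.extend_apply' _ _ _ (by simpa using hn)]
      simp
    · refine (hU x).congr_fun fun i => ?_
      simp [he.extend_apply]

variable {ι κ : Type*} {K : ℝ}

lemma EllOneSeries.norm_le {U : X →L[ℝ] Y} (h : EllOneSeries ι K U) (x : X) :
    ‖U x‖ ≤ K * ‖x‖ := by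
  obtain ⟨r, s, hs, hr, hU⟩ := h
  refine le_of_tendsto (hU x).norm (Filter.Eventually.of_forall fun t => ?_)
  refine (norm_sum_le _ _).trans (le_trans (Finset.sum_le_sum fun i _ => ?_) (hr x t))
  rw [norm_smul]
  exact mul_le_of_le_one_right (norm_nonneg _) (hs i)

lemma summable_smul_of_bound [CompleteSpace Y] {r : ι → X →L[ℝ] ℝ} {s : ι → Y}
    (hs : ∀ i, ‖s i‖ ≤ 1) (hr : ∀ x (t : Finset ι), ∑ i ∈ t, ‖r i x‖ ≤ K * ‖x‖) (x : X) :
    Summable fun i => r i x • s i := by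
  refine Summable.of_norm_bounded (summable_of_sum_le (fun i => norm_nonneg (r i x)) (hr x)) ?_
  intro i
  rw [norm_smul]
  exact mul_le_of_le_one_right (norm_nonneg _) (hs i)

lemma EllOneSeries.zero : EllOneSeries ℕ 0 (0 : X →L[ℝ] Y) :=
  ⟨0, 0, by simp, by simp, fun x => by simp⟩

lemma EllOneSeries.mono {K' : ℝ} {U : X →L[ℝ] Y} (h : EllOneSeries ι K U) (hK : K ≤ K') :
    EllOneSeries ι K' U := by
  obtain ⟨r, s, hs, hr, hU⟩ := h
  exact ⟨r, s, hs, fun x t => (hr x t).trans (by gcongr), hU⟩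

lemma EllOneSeries.smul {U : X →L[ℝ] Y} (h : EllOneSeries ι K U) (c : ℝ) :
    EllOneSeries ι (|c| * K) (c • U) := by
  obtain ⟨r, s, hs, hr, hU⟩ := h
  refine ⟨fun i => c • r i, s, hs, fun x t => ?_, fun x => ?_⟩
  · simp only [smul_apply, norm_smul, ← Finset.mul_sum, Real.norm_eq_abs c]
    rw [mul_assoc]
    gcongr
    exact hr x t
  · simpa [mul_smul] using (hU x).const_smul c

lemma EllOneSeries.add {K' : ℝ} {U V : X →L[ℝ] Y} (hU : EllOneSeries ℕ K U)
    (hV : EllOneSeries ℕ K' V) : EllOneSeries ℕ (K + K') (U + V) := by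
  obtain ⟨r, s, hs, hr, hU⟩ := hU
  obtain ⟨r', s', hs', hr', hV⟩ := hV
  have : EllOneSeries (ℕ ⊕ ℕ) (K + K') (U + V) := by
    refine ⟨Sum.elim r r', Sum.elim s s', ?_, fun x t => ?_, fun x => ?_⟩
    · rintro (i | i)
      · exact hs i
      · exact hs' i
    · have h1 : t = t.toLeft.disjSum t.toRight := (Finset.toLeft_disjSum_toRight).symm
      rw [h1, Finset.sum_disjSum, add_mul]
      exact add_le_add (hr x _) (hr' x _)
    · exact HasSum.sum (f := fun i => Sum.elim r r' i x • Sum.elim s s' i) (hU x) (hV x)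
  exact this.toNat

lemma EllOneSeries.exists_factor [CompleteSpace Y] {U : X →L[ℝ] Y} (h : EllOneSeries ℕ K U) :
    ∃ (R : X →L[ℝ] ellOne) (S : ellOne →L[ℝ] Y), U = S.comp R := by
  obtain ⟨r, s, hs, hr, hU⟩ := h
  have hS : ∀ i (c : ℝ), ‖(ContinuousLinearMap.toSpanSingleton ℝ (s i)) c‖ ≤ 1 * ‖c‖ := by
    intro i c
    rw [ContinuousLinearMap.toSpanSingleton_apply, norm_smul, one_mul]
    exact mul_le_of_le_one_right (norm_nonneg _) (hs i)
  refine ⟨lpOneMk r K hr,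
    lpOneSum (fun i => ContinuousLinearMap.toSpanSingleton ℝ (s i)) 1 hS, ?_⟩
  ext x
  exact (hU x).unique (lpOneSum_hasSum _ 1 hS (lpOneMk r K hr x))

lemma exists_ellOneSeries_comp (R : X →L[ℝ] ellOne) (S : ellOne →L[ℝ] Y) :
    ∃ K, EllOneSeries ℕ K (S.comp R) := by
  have hc : (0 : ℝ) < ‖S‖ + 1 := by positivity
  refine ⟨(‖S‖ + 1) * ‖R‖, fun i => (‖S‖ + 1) • (lp.evalCLM ℝ (fun _ : ℕ => ℝ) 1 i).comp R,
    fun i => (‖S‖ + 1)⁻¹ • S (lp.single 1 i 1), fun i => ?_, fun x t => ?_, fun x => ?_⟩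
  · rw [norm_smul, norm_inv, Real.norm_of_nonneg hc.le, inv_mul_le_iff₀ hc, mul_one]
    refine (S.le_opNorm _).trans ?_
    rw [lp.norm_single (by simp), norm_one]
    linarith
  · simp only [smul_apply, norm_smul, ← Finset.mul_sum,
      Real.norm_of_nonneg hc.le]
    rw [mul_assoc]
    gcongr
    exact (lpOne_sum_norm_le (R x) t).trans (R.le_opNorm x)
  · have h := (lp.hasSum_single (by simp) (R x)).mapL S
    refine h.congr_fun fun i => ?_
    have h1 : lp.single 1 i (R x i) = (R x i) • lp.single (E := fun _ : ℕ => ℝ) 1 i (1 : ℝ) := by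
      rw [← lp.single_smul]; simp
    rw [h1, map_smul]
    change ((‖S‖ + 1) * R x i) • (‖S‖ + 1)⁻¹ • S (lp.single 1 i 1) = R x i • S (lp.single 1 i 1)
    rw [smul_smul]
    congr 1
    field_simp

/-- Uniform series factorizations of the restrictions of an operator to the summands of an
`ℓ¹`-sum fit together. -/
lemma EllOneSeries.lpOneSum {F : ℕ → Type*} [∀ i, NormedAddCommGroup (F i)]
    [∀ i, NormedSpace ℝ (F i)] [CompleteSpace Y] (hK : 0 ≤ K) {U : ∀ n, F n →L[ℝ] Y}
    (h : ∀ n, EllOneSeries ℕ K (U n)) :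
    EllOneSeries ℕ K (lpOneSum U K fun n x => (h n).norm_le x) := by
  classical
  have h' := h
  choose r s hs hr hU using h'
  have hb : ∀ (f : lp F 1) (t : Finset (ℕ × ℕ)),
      ∑ p ∈ t, ‖((r p.1 p.2).comp (lp.evalCLM ℝ F 1 p.1)) f‖ ≤ K * ‖f‖ := by
    intro f t
    have hsub : t ⊆ t.image Prod.fst ×ˢ t.image Prod.snd := Finset.subset_product
    refine (Finset.sum_le_sum_of_subset_of_nonneg hsub fun _ _ _ => norm_nonneg _).trans ?_
    rw [Finset.sum_product]
    refine (Finset.sum_le_sum fun n _ => hr n (f n) _).trans ?_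
    rw [← Finset.mul_sum]
    gcongr
    exact lpOne_sum_norm_le f _
  have : EllOneSeries (ℕ × ℕ) K (_root_.lpOneSum U K fun n x => (h n).norm_le x) := by
    refine ⟨fun p => (r p.1 p.2).comp (lp.evalCLM ℝ F 1 p.1), fun p => s p.1 p.2,
      fun p => hs p.1 p.2, hb, fun f => ?_⟩
    have hsum := (summable_smul_of_bound (fun p : ℕ × ℕ => hs p.1 p.2) hb f).hasSum
    have h2 := hsum.prod_fiberwise fun n => hU n (f n)
    rwa [h2.unique (lpOneSum_hasSum U K (fun n x => (h n).norm_le x) f)] at hsum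
  exact this.toNat

/-- Operators with finite-rank blocks of bounded rank factor through `ℓ¹`. -/
lemma ellOneSeries_finsetProj {F : ℕ → Type*} [∀ i, NormedAddCommGroup (F i)]
    [∀ i, InnerProductSpace ℝ (F i)] [∀ i, CompleteSpace (F i)] {T : X →L[ℝ] lp F 1} {L : ℕ}
    (hT : ∀ x, ‖T x‖ ≤ ‖x‖)
    {Q : ∀ m, Finset (F m)} (hQ : ∀ m, Orthonormal ℝ (fun y : Q m => (y : F m)))
    (hQL : ∀ m, (Q m).card ≤ L) {U : X →L[ℝ] lp F 1}
    (hU : ∀ x m, U x m = finsetProj (Q m) (T x m)) : EllOneSeries ℕ L U := by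
  classical
  have hb : ∀ x (t : Finset (Σ m, Q m)),
      ∑ p ∈ t, ‖((innerSL ℝ (p.2 : F p.1)).comp ((lp.evalCLM ℝ F 1 p.1).comp T)) x‖ ≤
        L * ‖x‖ := by
    intro x t
    have hsub : t ⊆ (t.image Sigma.fst).sigma fun _ => Finset.univ := fun p hp => by
      simp only [Finset.mem_sigma, Finset.mem_univ, and_true]
      exact Finset.mem_image_of_mem _ hp
    refine (Finset.sum_le_sum_of_subset_of_nonneg hsub fun _ _ _ => norm_nonneg _).trans ?_
    rw [Finset.sum_sigma]
    have h1 : ∀ m, ∑ y : Q m, ‖((innerSL ℝ (y : F m)).comp ((lp.evalCLM ℝ F 1 m).comp T)) x‖ ≤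
        L * ‖T x m‖ := by
      intro m
      have h2 : ∀ y : Q m, ‖((innerSL ℝ (y : F m)).comp ((lp.evalCLM ℝ F 1 m).comp T)) x‖ ≤
          ‖T x m‖ := fun y => by
        have := norm_inner_le_norm (𝕜 := ℝ) (y : F m) (T x m)
        rwa [(hQ m).1 y, one_mul] at this
      refine (Finset.sum_le_sum fun y _ => h2 y).trans ?_
      rw [Finset.sum_const, nsmul_eq_mul, Finset.card_univ, Fintype.card_coe]
      gcongr
      exact hQL m
    refine (Finset.sum_le_sum fun m _ => h1 m).trans ?_
    rw [← Finset.mul_sum]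
    gcongr
    exact (lpOne_sum_norm_le _ _).trans (hT x)
  have hs : ∀ p : Σ m, Q m, ‖lp.single (E := F) 1 p.1 (p.2 : F p.1)‖ ≤ 1 := fun p => by
    rw [lp.norm_single (by simp)]
    exact ((hQ p.1).1 p.2).le
  have : EllOneSeries (Σ m, Q m) L U := by
    refine ⟨_, fun p => lp.single 1 p.1 (p.2 : F p.1), hs, hb, fun x => ?_⟩
    have hsum := (summable_smul_of_bound hs hb x).hasSum
    have h2 := hsum.sigma fun m => hasSum_fintype _
    have h3 := lp.hasSum_single (by simp) (U x)
    have h4 : ∀ m, ∑ y : Q m, ((innerSL ℝ (y : F m)).comp ((lp.evalCLM ℝ F 1 m).comp T)) x •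
        lp.single (E := F) 1 m (y : F m) = lp.single 1 m (U x m) := by
      intro m
      rw [hU, finsetProj_apply, ← Finset.sum_coe_sort (Q m)]
      change _ = lp.singleContinuousLinearMap ℝ F 1 m _
      rw [map_sum]
      exact Finset.sum_congr rfl fun y _ => (lp.single_smul 1 m _ _).symm
    simp only [h4] at h2
    rwa [h2.unique h3] at hsum
  exact this.toNat

/-- Finite-rank operators on a Hilbert space factor through `ℓ¹`. -/
lemma ellOneSeries_comp_finsetProj {H : Type*} [NormedAddCommGroup H] [InnerProductSpace ℝ H]
    {T : H →L[ℝ] Y} {L : ℕ} (hT : ∀ x, ‖T x‖ ≤ ‖x‖) {Q : Finset H}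
    (hQ : Orthonormal ℝ (fun y : Q => (y : H))) (hQL : Q.card ≤ L) :
    EllOneSeries ℕ L (T.comp (finsetProj Q)) := by
  have : EllOneSeries Q L (T.comp (finsetProj Q)) := by
    refine ⟨fun y => innerSL ℝ (y : H), fun y => T y, fun y => (hT y).trans (hQ.1 y).le,
      fun x t => ?_, fun x => ?_⟩
    · have h2 : ∀ y : Q, ‖innerSL ℝ (y : H) x‖ ≤ ‖x‖ := fun y => by
        have := norm_inner_le_norm (𝕜 := ℝ) (y : H) x
        rwa [hQ.1 y, one_mul] at this
      refine (Finset.sum_le_sum fun y _ => h2 y).trans ?_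
      rw [Finset.sum_const, nsmul_eq_mul]
      gcongr
      exact (Finset.card_le_univ t).trans (by simpa using hQL)
    · convert hasSum_fintype _ using 1
      rw [ContinuousLinearMap.comp_apply, finsetProj_apply, map_sum, ← Finset.sum_coe_sort Q]
      exact Finset.sum_congr rfl fun y _ => map_smul _ _ _
  exact this.toNat

end Factor

section Separation

variable {X Y : Type*} [NormedAddCommGroup X] [NormedSpace ℝ X]
  [NormedAddCommGroup Y] [NormedSpace ℝ Y]

/-- A convex set of operators none of which approximates `T` on a finite set stays away from `T`
in a weighted average over this set. -/
lemma exists_weights {α : Type*} [Fintype α] {𝒰 : Set (X →L[ℝ] Y)} (h𝒰 : Convex ℝ 𝒰)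
    (hne : 𝒰.Nonempty) (T : X →L[ℝ] Y) (x : α → X) {ε : ℝ} (hε : 0 < ε)
    (h : ∀ U ∈ 𝒰, ∃ i, ε ≤ ‖(T - U) (x i)‖) :
    ∃ μ : α → ℝ, (∀ i, 0 ≤ μ i) ∧ ∑ i, μ i = 1 ∧ ∀ U ∈ 𝒰, ε / 2 ≤ ∑ i, μ i * ‖(T - U) (x i)‖ := by
  classical
  set O : Set (α → ℝ) := Set.pi Set.univ fun _ => Set.Iio ε
  set C : Set (α → ℝ) := {v | ∃ U ∈ 𝒰, ∀ i, ‖(T - U) (x i)‖ ≤ v i}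
  have hOc : Convex ℝ O := convex_pi fun _ _ => convex_Iio ε
  have hOo : IsOpen O := isOpen_set_pi Set.finite_univ fun _ _ => isOpen_Iio
  have hCc : Convex ℝ C := by
    rintro v ⟨U, hU, hv⟩ v' ⟨U', hU', hv'⟩ a b ha hb hab
    refine ⟨a • U + b • U', h𝒰 hU hU' ha hb hab, fun i => ?_⟩
    have : (T - (a • U + b • U')) (x i) = a • (T - U) (x i) + b • (T - U') (x i) := by
      simp only [sub_apply, add_apply, smul_apply, smul_sub]
      rw [sub_add_sub_comm, ← add_smul, hab, one_smul]
    rw [this]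
    refine (norm_add_le _ _).trans ?_
    rw [norm_smul, norm_smul, Real.norm_of_nonneg ha, Real.norm_of_nonneg hb]
    exact add_le_add (mul_le_mul_of_nonneg_left (hv i) ha) (mul_le_mul_of_nonneg_left (hv' i) hb)
  have hdisj : Disjoint O C := by
    rw [Set.disjoint_left]
    rintro v hvO ⟨U, hU, hv⟩
    obtain ⟨i, hi⟩ := h U hU
    exact absurd (hi.trans (hv i)) (not_le.2 (hvO i trivial))
  obtain ⟨f, u, hfO, hfC⟩ := geometric_hahn_banach_open hOc hOo hCc hdisj
  set c : α → ℝ := fun i => f (Pi.single i 1)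
  have hf : ∀ v, f v = ∑ i, c i * v i := by
    intro v
    conv_lhs => rw [← Finset.univ_sum_single v]
    rw [map_sum]
    refine Finset.sum_congr rfl fun i _ => ?_
    have : (Pi.single i (v i) : α → ℝ) = v i • Pi.single i (1 : ℝ) := by
      rw [← Pi.single_smul, smul_eq_mul, mul_one]
    rw [this, map_smul, smul_eq_mul, mul_comm]
  obtain ⟨U₀, hU₀⟩ := hne
  have hc0 : ∀ i, 0 ≤ c i := by
    intro i
    by_contra hneg
    push Not at hneg
    set v₀ : α → ℝ := fun i => ‖(T - U₀) (x i)‖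
    have h1 : ∀ t : ℝ, 0 ≤ t → u ≤ f v₀ + t * c i := by
      intro t ht
      have := hfC (v₀ + t • Pi.single i 1) ⟨U₀, hU₀, fun j => by
        have : (0 : ℝ) ≤ (Pi.single i 1 : α → ℝ) j := by
          by_cases hj : j = i
          · subst hj; simp
          · simp [hj]
        simp only [Pi.add_apply, Pi.smul_apply, smul_eq_mul]
        have := mul_nonneg ht this
        linarith⟩
      rwa [map_add, map_smul, smul_eq_mul] at this
    have h2 := h1 ((|f v₀ - u| + 1) / (-c i)) (by
      have : 0 < -c i := by linarith
      positivity)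
    have h3 : (|f v₀ - u| + 1) / (-c i) * c i = -(|f v₀ - u| + 1) := by
      rw [div_neg, neg_mul, div_mul_cancel₀ _ hneg.ne]
    rw [h3] at h2
    have := le_abs_self (f v₀ - u)
    linarith
  have hO2 : ε / 2 * ∑ i, c i < u := by
    have := hfO (fun _ => ε / 2) fun i _ => by simp only [Set.mem_Iio]; linarith
    rw [hf, ← Finset.sum_mul] at this
    linarith
  have hcs : 0 < ∑ i, c i := by
    refine lt_of_le_of_ne (Finset.sum_nonneg fun i _ => hc0 i) fun h0 => ?_
    have hz : ∀ i, c i = 0 := fun i =>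
      (Finset.sum_eq_zero_iff_of_nonneg fun i _ => hc0 i).1 h0.symm i (Finset.mem_univ i)
    have := hfC (fun i => ‖(T - U₀) (x i)‖) ⟨U₀, hU₀, fun i => le_rfl⟩
    rw [hf] at this
    simp only [hz, zero_mul, Finset.sum_const_zero, mul_zero] at this hO2
    linarith
  refine ⟨fun i => c i / ∑ j, c j, fun i => div_nonneg (hc0 i) hcs.le, ?_, fun U hU => ?_⟩
  · rw [← Finset.sum_div, div_self hcs.ne']
  · have := hfC (fun i => ‖(T - U) (x i)‖) ⟨U, hU, fun i => le_rfl⟩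
    rw [hf] at this
    simp only [div_mul_eq_mul_div]
    rw [← Finset.sum_div, le_div_iff₀ hcs]
    linarith

/-- If no operator with a bounded `ℓ¹`-series approximates `T` in norm, then none does so in
quadratic mean with respect to suitable weights. -/
lemma exists_family_of_not_approx [FiniteDimensional ℝ X] {T : X →L[ℝ] Y}
    (hT : ∀ x, ‖T x‖ ≤ ‖x‖) {K ε : ℝ} (hK : 0 ≤ K) (hε : 0 < ε)
    (h : ¬ ∃ U : X →L[ℝ] Y, EllOneSeries ℕ K U ∧ ∀ x, ‖(T - U) x‖ ≤ ε * ‖x‖) :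
    ∃ (t : Finset X) (μ : t → ℝ) (z : t → X), (∑ i, μ i ^ 2 = 1) ∧ ∑ i, ‖z i‖ ^ 2 ≤ 1 ∧
      ∀ U : X →L[ℝ] Y, EllOneSeries ℕ K U → ε / 4 ≤ ∑ i, μ i * ‖(T - U) (z i)‖ := by
  classical
  have := FiniteDimensional.proper_real X
  set δ := ε / (2 * (1 + K)) with hδ
  have hδ0 : 0 < δ := by positivity
  obtain ⟨s, hs, hsf, hcov⟩ := (isCompact_sphere (0 : X) 1).finite_cover_balls hδ0
  set t : Finset X := hsf.toFinset with ht
  have hconv : Convex ℝ {U : X →L[ℝ] Y | EllOneSeries ℕ K U} := by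
    intro U hU V hV a b ha hb hab
    have := (hU.smul a).add (hV.smul b)
    rw [abs_of_nonneg ha, abs_of_nonneg hb, ← add_mul, hab, one_mul] at this
    exact this
  have hnet : ∀ U ∈ {U : X →L[ℝ] Y | EllOneSeries ℕ K U},
      ∃ i : t, ε / 2 ≤ ‖(T - U) (i : X)‖ := by
    intro U hU
    have : ∃ x, ε * ‖x‖ < ‖(T - U) x‖ := by
      by_contra hcon
      push Not at hcon
      exact h ⟨U, hU, hcon⟩
    obtain ⟨x, hx⟩ := this
    have hx0 : 0 < ‖x‖ := by
      rw [norm_pos_iff]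
      rintro rfl
      simp at hx
    set y := ‖x‖⁻¹ • x with hy
    have hyn : ‖y‖ = 1 := by rw [hy, norm_smul, norm_inv, norm_norm, inv_mul_cancel₀ hx0.ne']
    have hyT : ε < ‖(T - U) y‖ := by
      rw [hy, map_smul, norm_smul, norm_inv, norm_norm, ← div_eq_inv_mul, lt_div_iff₀ hx0]
      exact hx
    have hmem := hcov (show y ∈ Metric.sphere (0 : X) 1 by simpa using hyn)
    simp only [Set.mem_iUnion, Metric.mem_ball, exists_prop] at hmem
    obtain ⟨w, hws, hwd⟩ := hmem
    refine ⟨⟨w, by simpa [ht] using hws⟩, ?_⟩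
    have h1 : ‖(T - U) (y - w)‖ ≤ (1 + K) * ‖y - w‖ := by
      rw [sub_apply, add_mul, one_mul]
      exact (norm_sub_le _ _).trans (add_le_add (hT _) (hU.norm_le _))
    rw [dist_eq_norm] at hwd
    have h2 : (1 + K) * ‖y - w‖ ≤ (1 + K) * δ := by gcongr
    have h3 : (1 + K) * δ = ε / 2 := by rw [hδ]; field_simp
    have h4 : ‖(T - U) y‖ ≤ ‖(T - U) (y - w)‖ + ‖(T - U) w‖ := by
      rw [map_sub]
      simpa using norm_add_le ((T - U) y - (T - U) w) ((T - U) w)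
    change ε / 2 ≤ ‖(T - U) w‖
    linarith
  obtain ⟨μ, hμ0, hμ1, hμ⟩ := exists_weights hconv ⟨0, EllOneSeries.zero.mono hK⟩ T
    (fun i : t => (i : X)) (half_pos hε) hnet
  refine ⟨t, fun i => √(μ i), fun i => √(μ i) • (i : X), ?_, ?_, fun U hU => ?_⟩
  · simpa only [Real.sq_sqrt (hμ0 _)] using hμ1
  · rw [← hμ1]
    refine (Finset.sum_congr rfl fun i _ => ?_).le
    have hi : ‖(i : X)‖ = 1 := by
      have := hs ((Set.Finite.mem_toFinset hsf).1 i.2)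
      simpa using this
    rw [norm_smul, hi, mul_one, Real.norm_eq_abs, sq_abs, Real.sq_sqrt (hμ0 i)]
  · refine le_trans (by linarith) ((hμ U hU).trans (Finset.sum_congr rfl fun i _ => ?_).le)
    rw [map_smul, norm_smul, Real.norm_of_nonneg (Real.sqrt_nonneg _), ← mul_assoc,
      Real.mul_self_sqrt (hμ0 i)]

end Separation

/-- A coercive operator on a Euclidean space is invertible. -/
lemma exists_inverse_of_coercive {V : Type*} [NormedAddCommGroup V] [InnerProductSpace ℝ V]
    [FiniteDimensional ℝ V] {Φ : V →L[ℝ] V} {δ : ℝ} (hδ : 0 < δ)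
    (h : ∀ c, δ * ‖c‖ ^ 2 ≤ ⟪c, Φ c⟫) :
    ∃ Ψ : V →L[ℝ] V, (∀ c, Ψ (Φ c) = c) ∧ ∀ c, ‖Ψ c‖ ≤ δ⁻¹ * ‖c‖ := by
  have hb : ∀ c, δ * ‖c‖ ≤ ‖Φ c‖ := by
    intro c
    rcases eq_or_ne c 0 with rfl | hc
    · simp
    have hcn : 0 < ‖c‖ := norm_pos_iff.2 hc
    have h1 := (h c).trans (real_inner_le_norm c (Φ c))
    have h2 : ‖c‖ * (δ * ‖c‖) ≤ ‖c‖ * ‖Φ c‖ := by linarith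
    exact le_of_mul_le_mul_left h2 hcn
  have hinj : Function.Injective (Φ : V →ₗ[ℝ] V) := by
    rw [injective_iff_map_eq_zero]
    intro c hc
    have hc' : Φ c = 0 := hc
    have := hb c
    rw [hc', norm_zero] at this
    have : ‖c‖ ≤ 0 := by nlinarith
    exact norm_le_zero_iff.1 this
  set e := LinearEquiv.ofInjectiveEndo (Φ : V →ₗ[ℝ] V) hinj
  have he' : ∀ c, e c = Φ c := fun c => rfl
  refine ⟨LinearMap.toContinuousLinearMap (e.symm : V →ₗ[ℝ] V), fun c => ?_, fun c => ?_⟩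
  · change e.symm (Φ c) = c
    rw [← he', e.symm_apply_apply]
  · change ‖e.symm c‖ ≤ _
    have := hb (e.symm c)
    rw [← he', e.apply_symm_apply] at this
    rwa [← div_eq_inv_mul, le_div_iff₀ hδ, mul_comm]

section Core

variable {F : ℕ → Type*} [∀ i, NormedAddCommGroup (F i)] [∀ i, InnerProductSpace ℝ (F i)]
  {H : Type*} [NormedAddCommGroup H] [InnerProductSpace ℝ H] {T : H →L[ℝ] lp F 1}
  {α : Type*} [Fintype α]

lemma sum_sqrt_coord_le (hT : ∀ x, ‖T x‖ ≤ ‖x‖) (z : α → H) (hz : ∑ i, ‖z i‖ ^ 2 ≤ 1)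
    (M : Finset ℕ) : ∑ m ∈ M, √(∑ i, ‖T (z i) m‖ ^ 2) ≤ 2 := by
  classical
  have h1 : ∀ m, √(∑ i, ‖T (z i) m‖ ^ 2) ≤
      2 * Finset.expect Finset.univ fun ω : α → Bool => ‖T (radSum id ω Finset.univ z) m‖ := by
    intro m
    refine (sqrt_sum_le_expect_norm_radSum (e := (id : α → α)) Function.injective_id
      (fun i => T (z i) m) Finset.univ).trans (le_of_eq ?_)
    congr 1
    refine Finset.expect_congr rfl fun ω _ => ?_
    have := map_radSum ((lp.evalCLM ℝ F 1 m).comp T) (id : α → α) ω Finset.univ z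
    exact congrArg norm this.symm
  refine (Finset.sum_le_sum fun m _ => h1 m).trans ?_
  rw [← Finset.mul_sum, ← Finset.expect_sum_comm]
  have h2 : ∀ ω : α → Bool, ∑ m ∈ M, ‖T (radSum id ω Finset.univ z) m‖ ≤
      1 / 2 + 1 / 2 * ‖radSum id ω Finset.univ z‖ ^ 2 := fun ω => by
    have h3 := (lpOne_sum_norm_le (T (radSum id ω Finset.univ z)) M).trans (hT _)
    nlinarith [sq_nonneg (‖radSum id ω Finset.univ z‖ - 1)]
  have h4 := Finset.expect_le_expect (s := (Finset.univ : Finset (α → Bool))) fun ω _ => h2 ω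
  rw [Finset.expect_add_distrib, ← Finset.mul_expect,
    expect_norm_sq_radSum_const Function.injective_id, Fintype.expect_const] at h4
  linarith

/-- Two flat families have sign combinations whose Gram matrices are simultaneously close to
scalar ones. -/
lemma exists_signs {κ : Type*} [Fintype κ] [DecidableEq κ] [DecidableEq α] {z : α → H}
    {h : ∀ m, α → F m} {L : ℕ} (hz : ∑ i, ‖z i‖ ^ 2 ≤ 1)
    (hzθ : ∀ w, ∑ i, ⟪z i, w⟫ ^ 2 ≤ 1 / L * ‖w‖ ^ 2) {M : Finset ℕ} {σ v : ℕ → ℝ}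
    (hσ : ∀ m ∈ M, 0 < σ m) (hv : ∀ m ∈ M, 0 < v m) (hvh : ∀ m ∈ M, v m ^ 2 = ∑ i, ‖h m i‖ ^ 2)
    (hhθ : ∀ m ∈ M, ∀ w, ∑ i, ⟪h m i, w⟫ ^ 2 ≤ σ m ^ 2 / L * ‖w‖ ^ 2) (hσM : ∑ m ∈ M, σ m ≤ 2) :
    ∃ ω : α × κ → Bool, gramDev (∑ i, ‖z i‖ ^ 2) (radCol z ω) +
      ∑ m ∈ M, 4 / (v m ^ 2 * σ m) * gramDev (v m ^ 2) (radCol (h m) ω) ≤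
        18 * (Fintype.card κ : ℝ) ^ 2 / L := by
  have h1 := expect_gramDev_radCol_le (κ := κ) hzθ
  have h2 : ∀ m ∈ M, Finset.expect Finset.univ (fun ω : α × κ → Bool =>
      4 / (v m ^ 2 * σ m) * gramDev (v m ^ 2) (radCol (h m) ω)) ≤
      8 * (Fintype.card κ : ℝ) ^ 2 / L * σ m := by
    intro m hm
    have h3 := expect_gramDev_radCol_le (κ := κ) (hhθ m hm)
    rw [← hvh m hm] at h3
    have hσm := hσ m hm
    have hvm := hv m hm
    rw [← Finset.mul_expect]
    refine (mul_le_mul_of_nonneg_left h3 (by positivity)).trans (le_of_eq ?_)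
    field_simp
    ring
  obtain ⟨ω, -, hω⟩ := Finset.exists_le_of_expect_le (s := (Finset.univ : Finset (α × κ → Bool)))
    (f := fun ω => gramDev (∑ i, ‖z i‖ ^ 2) (radCol z ω) +
      ∑ m ∈ M, 4 / (v m ^ 2 * σ m) * gramDev (v m ^ 2) (radCol (h m) ω))
    (a := 18 * (Fintype.card κ : ℝ) ^ 2 / L) Finset.univ_nonempty (by
      rw [Finset.expect_add_distrib, Finset.expect_sum_comm]
      have h4 := (Finset.sum_le_sum h2).trans (le_of_eq (Finset.mul_sum _ _ _).symm)
      have h5 : 8 * (Fintype.card κ : ℝ) ^ 2 / L * ∑ m ∈ M, σ m ≤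
          8 * (Fintype.card κ : ℝ) ^ 2 / L * 2 := by gcongr
      have h6 : 2 * (Fintype.card κ : ℝ) ^ 2 * (1 / L * ∑ a, ‖z a‖ ^ 2) ≤
          2 * (Fintype.card κ : ℝ) ^ 2 * (1 / L * 1) := by gcongr
      have h7 : 2 * (Fintype.card κ : ℝ) ^ 2 * (1 / L * 1) +
        8 * (Fintype.card κ : ℝ) ^ 2 / L * 2 = 18 * (Fintype.card κ : ℝ) ^ 2 / L := by ring
      linarith)
  exact ⟨ω, hω⟩

/-- The operator from a Euclidean space mapping the standard basis to a given family. -/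
def euclSum {κ : Type*} [Fintype κ] {X : Type*} [NormedAddCommGroup X] [NormedSpace ℝ X]
    (u : κ → X) : EuclideanSpace ℝ κ →L[ℝ] X :=
  ∑ j, (EuclideanSpace.proj j : EuclideanSpace ℝ κ →L[ℝ] ℝ).smulRight (u j)

lemma euclSum_apply {κ : Type*} [Fintype κ] {X : Type*} [NormedAddCommGroup X] [NormedSpace ℝ X]
    (u : κ → X) (c : EuclideanSpace ℝ κ) : euclSum u c = ∑ j, c j • u j := by
  simp [euclSum]

lemma exists_identity_factor [∀ i, CompleteSpace (F i)] {κ : Type*} [Fintype κ] [DecidableEq κ]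
    {w : κ → H} {s : ℝ} (hs1 : s ≤ 1) (hw : gramDev s w ≤ 1) {Q : ∀ m, Finset (F m)}
    (hQ : ∀ m, Orthonormal ℝ (fun y : Q m => (y : F m))) {M : Finset ℕ} {σ v : ℕ → ℝ}
    (hv : ∀ m ∈ M, 0 < v m) (hvσ : ∀ m ∈ M, v m ≤ σ m)
    (hg : ∀ m ∈ M, gramDev (v m ^ 2) (fun j => T (w j) m - finsetProj (Q m) (T (w j) m)) ≤
      (v m ^ 2 / 2) ^ 2) {δ : ℝ} (hδ : 0 < δ) (hδM : 2 * δ ≤ ∑ m ∈ M, v m ^ 2 / σ m) :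
    ∃ (A : EuclideanSpace ℝ κ →L[ℝ] H) (B : lp F 1 →L[ℝ] EuclideanSpace ℝ κ),
      (∀ c, ‖A c‖ ≤ 2 * ‖c‖) ∧ (∀ y, ‖B y‖ ≤ 2 / δ * ‖y‖) ∧ ∀ c, B (T (A c)) = c := by
  set A := euclSum w
  set D : ∀ m, EuclideanSpace ℝ κ →L[ℝ] F m := fun m =>
    euclSum fun j => T (w j) m - finsetProj (Q m) (T (w j) m) with hD
  have hDA : ∀ m c, D m c = T (A c) m - finsetProj (Q m) (T (A c) m) := by
    intro m c
    let Λ : H →L[ℝ] F m := (ContinuousLinearMap.id ℝ (F m) - finsetProj (Q m)).comp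
      ((lp.evalCLM ℝ F 1 m).comp T)
    have h2 : Λ (euclSum w c) = ∑ j, c j • Λ (w j) := by
      rw [euclSum_apply, map_sum]
      simp only [map_smul]
    exact (euclSum_apply _ c).trans h2.symm
  have hDg : ∀ m ∈ M, ∀ c, |‖D m c‖ ^ 2 - v m ^ 2 * ‖c‖ ^ 2| ≤ v m ^ 2 / 2 * ‖c‖ ^ 2 := by
    intro m hm c
    have := abs_norm_sq_sum_smul_sub_le (by positivity) (hg m hm) c
    rwa [← euclSum_apply] at this
  have hDle : ∀ m ∈ M, ∀ c, ‖D m c‖ ≤ 2 * v m * ‖c‖ := by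
    intro m hm c
    have h1 := (abs_le.1 (hDg m hm c)).2
    have h2 := hv m hm
    refine abs_le_of_sq_le_sq' ?_ (by positivity) |>.2
    nlinarith [sq_nonneg (v m * ‖c‖)]
  have hDge : ∀ m ∈ M, ∀ c, v m ^ 2 / 2 * ‖c‖ ^ 2 ≤ ‖D m c‖ ^ 2 := by
    intro m hm c
    have h1 := (abs_le.1 (hDg m hm c)).1
    linarith
  have hσ : ∀ m ∈ M, 0 < σ m := fun m hm => (hv m hm).trans_le (hvσ m hm)
  have hAle : ∀ c, ‖A c‖ ≤ 2 * ‖c‖ := by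
    intro c
    have h1 := (abs_le.1 (abs_norm_sq_sum_smul_sub_le zero_le_one
      (by rwa [one_pow] : gramDev s w ≤ 1 ^ 2) c)).2
    rw [← euclSum_apply] at h1
    refine abs_le_of_sq_le_sq' ?_ (by positivity) |>.2
    nlinarith [sq_nonneg ‖c‖]
  set B₀ : lp F 1 →L[ℝ] EuclideanSpace ℝ κ :=
    ∑ m ∈ M, (σ m)⁻¹ • (ContinuousLinearMap.adjoint (D m)).comp (lp.evalCLM ℝ F 1 m) with hB₀
  have hB₀a : ∀ y, B₀ y = ∑ m ∈ M, (σ m)⁻¹ • (ContinuousLinearMap.adjoint (D m)) (y m) := by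
    intro y
    simp only [hB₀, sum_apply]
    rfl
  have hB₀le : ∀ y, ‖B₀ y‖ ≤ 2 * ‖y‖ := by
    intro y
    rw [hB₀a]
    refine (norm_sum_le _ _).trans ?_
    refine (Finset.sum_le_sum (g := fun m => 2 * ‖y m‖) fun m hm => ?_).trans ?_
    · have h1 : ‖ContinuousLinearMap.adjoint (D m)‖ ≤ 2 * v m := by
        rw [LinearIsometryEquiv.norm_map]
        exact ContinuousLinearMap.opNorm_le_bound _ (by have := hv m hm; positivity) (hDle m hm)
      have h2 := hσ m hm
      rw [norm_smul, norm_inv, Real.norm_of_nonneg h2.le, inv_mul_le_iff₀ h2]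
      refine (ContinuousLinearMap.le_of_opNorm_le _ h1 _).trans ?_
      have := mul_le_mul_of_nonneg_right (hvσ m hm) (norm_nonneg (y m))
      linarith
    · rw [← Finset.mul_sum]
      gcongr
      exact lpOne_sum_norm_le y M
  have hco : ∀ c, δ * ‖c‖ ^ 2 ≤ ⟪c, (B₀.comp (T.comp A)) c⟫ := by
    intro c
    have h1 : ⟪c, (B₀.comp (T.comp A)) c⟫ = ∑ m ∈ M, (σ m)⁻¹ * ‖D m c‖ ^ 2 := by
      change ⟪c, B₀ (T (A c))⟫ = _
      rw [hB₀a, inner_sum]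
      refine Finset.sum_congr rfl fun m _ => ?_
      rw [real_inner_smul_right, ContinuousLinearMap.adjoint_inner_right, hDA,
        ← inner_sub_finsetProj_sub (hQ m), real_inner_self_eq_norm_sq]
    rw [h1]
    have h2 : (∑ m ∈ M, v m ^ 2 / σ m) / 2 * ‖c‖ ^ 2 ≤ ∑ m ∈ M, (σ m)⁻¹ * ‖D m c‖ ^ 2 := by
      rw [Finset.sum_div, Finset.sum_mul]
      refine Finset.sum_le_sum fun m hm => ?_
      have h3 := hσ m hm
      have h4 := mul_le_mul_of_nonneg_left (hDge m hm c) (inv_nonneg.2 h3.le)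
      refine le_trans (le_of_eq ?_) h4
      ring
    refine le_trans ?_ h2
    gcongr
    linarith
  obtain ⟨Ψ, hΨ, hΨle⟩ := exists_inverse_of_coercive hδ hco
  refine ⟨A, Ψ.comp B₀, hAle, fun y => ?_, hΨ⟩
  refine (hΨle _).trans ((mul_le_mul_of_nonneg_left (hB₀le y) (inv_nonneg.2 hδ.le)).trans
    (le_of_eq ?_))
  ring

/-- An operator into an `ℓ¹`-sum of Hilbert spaces which stays away, in quadratic mean, from all
operators with a suitably bounded `ℓ¹`-series allows one to factor the identity of a Euclidean
space. -/
lemma exists_identity_factor_of_far [∀ i, CompleteSpace (F i)] (hT : ∀ x, ‖T x‖ ≤ ‖x‖) {k L : ℕ}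
    {ε : ℝ} (hε : 0 < ε) (hL0 : 0 < L) (hL1 : 18 * (k : ℝ) ^ 2 ≤ L)
    (hL2 : 18 * (k : ℝ) ^ 2 * 128 ≤ ε ^ 2 * L) {z : α → H} {μ : α → ℝ}
    (hz : ∑ i, ‖z i‖ ^ 2 ≤ 1) (hμ : ∑ i, μ i ^ 2 ≤ 1)
    (hU : ∀ U : H →L[ℝ] lp F 1, EllOneSeries ℕ (2 * L) U → ε ≤ ∑ i, μ i * ‖(T - U) (z i)‖) :
    ∃ (A : EuclideanSpace ℝ (Fin k) →L[ℝ] H) (B : lp F 1 →L[ℝ] EuclideanSpace ℝ (Fin k)),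
      (∀ c, ‖A c‖ ≤ 2 * ‖c‖) ∧ (∀ y, ‖B y‖ ≤ 64 / ε ^ 2 * ‖y‖) ∧ ∀ c, B (T (A c)) = c := by
  classical
  have hLp : (0 : ℝ) < L := by exact_mod_cast hL0
  obtain ⟨Y, hY, hYL, hYflat⟩ := exists_flat_compression z hL0
  set z' : α → H := fun i => z i - finsetProj Y (z i) with hz'
  have hz'1 : ∑ i, ‖z' i‖ ^ 2 ≤ 1 := (Finset.sum_le_sum fun i _ => by
    gcongr; exact norm_sub_finsetProj_le hY (z i)).trans hz
  set a : ∀ m, α → F m := fun m i => T (z' i) m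
  set σ : ℕ → ℝ := fun m => √(∑ i, ‖a m i‖ ^ 2)
  have hσsq : ∀ m, σ m ^ 2 = ∑ i, ‖a m i‖ ^ 2 := fun m => Real.sq_sqrt (by positivity)
  have hσM : ∀ M : Finset ℕ, ∑ m ∈ M, σ m ≤ 2 := sum_sqrt_coord_le hT z' hz'1
  choose Q hQ hQL hQflat using fun m => exists_flat_compression (a m) hL0
  set h : ∀ m, α → F m := fun m i => a m i - finsetProj (Q m) (a m i)
  set v : ℕ → ℝ := fun m => √(∑ i, ‖h m i‖ ^ 2)
  have hvsq : ∀ m, v m ^ 2 = ∑ i, ‖h m i‖ ^ 2 := fun m => Real.sq_sqrt (by positivity)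
  have hvσ : ∀ m, v m ≤ σ m := fun m => Real.sqrt_le_sqrt (Finset.sum_le_sum fun i _ => by
    gcongr; exact norm_sub_finsetProj_le (hQ m) (a m i))
  have hv0 : ∀ m, 0 ≤ v m := fun m => Real.sqrt_nonneg _
  -- the part of `T` with an `ℓ¹`-series
  set T' : H →L[ℝ] lp F 1 := T.comp (ContinuousLinearMap.id ℝ H - finsetProj Y)
  have hT'le : ∀ x, ‖T' x‖ ≤ ‖x‖ := fun x => (hT _).trans (norm_sub_finsetProj_le hY x)
  set W : H →L[ℝ] lp F 1 := lpOneMk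
    (fun m => (finsetProj (Q m)).comp ((lp.evalCLM ℝ F 1 m).comp T')) 2 (fun x s => by
      refine (Finset.sum_le_sum (g := fun m => 2 * ‖T' x m‖) fun m _ => ?_).trans ?_
      · change ‖finsetProj (Q m) (T' x m)‖ ≤ _
        have h1 := norm_sub_finsetProj_le (hQ m) (T' x m)
        have h2 := norm_sub_le (T' x m) (T' x m - finsetProj (Q m) (T' x m))
        rw [sub_sub_cancel] at h2
        linarith
      · rw [← Finset.mul_sum]
        gcongr
        exact (lpOne_sum_norm_le _ s).trans (hT'le x)) with hW
  have hWs : EllOneSeries ℕ (L : ℝ) W :=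
    ellOneSeries_finsetProj hT'le hQ hQL fun x m => rfl
  have hUs : EllOneSeries ℕ (2 * L : ℝ) (T.comp (finsetProj Y) + W) := by
    rw [two_mul]
    exact (ellOneSeries_comp_finsetProj hT hY hYL).add hWs
  have hfar := hU _ hUs
  have hcoord : ∀ i m, (T - (T.comp (finsetProj Y) + W)) (z i) m = h m i := by
    intro i m
    have h1 : (T - (T.comp (finsetProj Y) + W)) (z i) = T (z' i) - W (z i) := by
      simp only [sub_apply, add_apply, hz', map_sub]
      exact sub_add_eq_sub_sub _ _ _
    rw [h1]
    rfl
  have hsum : HasSum (fun m => ∑ i, μ i * ‖h m i‖)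
      (∑ i, μ i * ‖(T - (T.comp (finsetProj Y) + W)) (z i)‖) :=
    hasSum_sum fun i _ => by
      have := (lpOne_hasSum_norm ((T - (T.comp (finsetProj Y) + W)) (z i))).mul_left (μ i)
      simpa only [hcoord] using this
  have hfar2 : ε / 2 < ∑ i, μ i * ‖(T - (T.comp (finsetProj Y) + W)) (z i)‖ := by linarith
  obtain ⟨M₀, hM₀⟩ := (hsum.eventually (lt_mem_nhds hfar2)).exists
  have hM₀v : ε / 2 ≤ ∑ m ∈ M₀, v m := hM₀.le.trans <| Finset.sum_le_sum fun m _ => by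
    refine abs_le_of_sq_le_sq' ?_ (hv0 m) |>.2
    refine (Finset.sum_mul_sq_le_sq_mul_sq _ _ _).trans ?_
    rw [hvsq]
    exact mul_le_of_le_one_left (by positivity) hμ
  set M := M₀.filter fun m => 0 < v m with hM
  have hMv : ε / 2 ≤ ∑ m ∈ M, v m := by
    rwa [hM, Finset.sum_filter_of_ne fun m _ hm => lt_of_le_of_ne (hv0 m) (Ne.symm hm)]
  have hMpos : ∀ m ∈ M, 0 < v m := fun m hm => (Finset.mem_filter.1 hm).2
  have hMσ : ∀ m ∈ M, 0 < σ m := fun m hm => (hMpos m hm).trans_le (hvσ m)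
  obtain ⟨ω, hω⟩ := exists_signs (κ := Fin k) (z := z') (h := h) (L := L) hz'1 (fun w => by
      refine (hYflat w).trans ?_
      gcongr) hMσ hMpos (fun m _ => hvsq m) (fun m _ w => by
      rw [hσsq]
      exact hQflat m w) (hσM M)
  rw [Fintype.card_fin] at hω
  set w : Fin k → H := radCol z' ω
  have hwm : ∀ m, (fun j => T (w j) m - finsetProj (Q m) (T (w j) m)) = radCol (h m) ω := by
    intro m
    ext1 j
    exact map_radCol ((ContinuousLinearMap.id ℝ (F m) - finsetProj (Q m)).comp
      ((lp.evalCLM ℝ F 1 m).comp T)) ω z' j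
  set R : ℕ → ℝ := fun m => 4 / (v m ^ 2 * σ m) * gramDev (v m ^ 2) (radCol (h m) ω)
  have hR0 : ∀ m ∈ M, 0 ≤ R m := fun m hm => by
    have := hMpos m hm
    have := hMσ m hm
    have := gramDev_nonneg (v m ^ 2) (radCol (h m) ω)
    positivity
  have hb1 : 18 * (k : ℝ) ^ 2 / L ≤ 1 := by rwa [div_le_one hLp]
  have hb2 : 18 * (k : ℝ) ^ 2 / L ≤ ε ^ 2 / 128 := by
    rw [div_le_div_iff₀ hLp (by norm_num)]
    exact hL2
  set Mg := M.filter fun m => gramDev (v m ^ 2) (radCol (h m) ω) ≤ (v m ^ 2 / 2) ^ 2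
  have hbad : ∀ m ∈ M.filter (fun m => ¬ gramDev (v m ^ 2) (radCol (h m) ω) ≤ (v m ^ 2 / 2) ^ 2),
      v m ^ 2 / σ m ≤ R m := by
    intro m hm
    obtain ⟨hmM, hmb⟩ := Finset.mem_filter.1 hm
    have h1 := hMpos m hmM
    have h2 := hMσ m hmM
    push Not at hmb
    have h3 := mul_le_mul_of_nonneg_left hmb.le
      (show 0 ≤ 4 / (v m ^ 2 * σ m) by positivity)
    refine le_trans (le_of_eq ?_) h3
    field_simp
    norm_num
  have hbads : ∑ m ∈ M.filter (fun m => ¬ gramDev (v m ^ 2) (radCol (h m) ω) ≤ (v m ^ 2 / 2) ^ 2),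
      v m ^ 2 / σ m ≤ ε ^ 2 / 128 := by
    refine (Finset.sum_le_sum hbad).trans ?_
    refine (Finset.sum_le_sum_of_subset_of_nonneg (Finset.filter_subset _ _)
      fun m hm _ => hR0 m hm).trans ?_
    have := gramDev_nonneg (∑ i, ‖z' i‖ ^ 2) w
    linarith
  have hall : 3 * ε ^ 2 / 32 ≤ ∑ m ∈ M, v m ^ 2 / σ m := by
    have h1 : ∀ m ∈ M, 2 * (ε / 8) * v m - (ε / 8) ^ 2 * σ m ≤ v m ^ 2 / σ m := by
      intro m hm
      rw [le_div_iff₀ (hMσ m hm)]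
      nlinarith [sq_nonneg (v m - ε / 8 * σ m)]
    have h2 := Finset.sum_le_sum h1
    rw [Finset.sum_sub_distrib, ← Finset.mul_sum, ← Finset.mul_sum] at h2
    have h3 := mul_le_mul_of_nonneg_left hMv (show 0 ≤ 2 * (ε / 8) by positivity)
    have h4 := mul_le_mul_of_nonneg_left (hσM M) (show 0 ≤ (ε / 8) ^ 2 by positivity)
    linarith
  have hgood : 2 * (ε ^ 2 / 32) ≤ ∑ m ∈ Mg, v m ^ 2 / σ m := by
    have := Finset.sum_filter_add_sum_filter_not M
      (fun m => gramDev (v m ^ 2) (radCol (h m) ω) ≤ (v m ^ 2 / 2) ^ 2) fun m => v m ^ 2 / σ m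
    have := sq_nonneg ε
    linarith
  obtain ⟨A, B, hA, hB, hAB⟩ := exists_identity_factor (T := T) hz'1
    (by linarith [Finset.sum_nonneg hR0] : gramDev (∑ i, ‖z' i‖ ^ 2) w ≤ 1) hQ
    (fun m hm => hMpos m (Finset.mem_filter.1 hm).1) (fun m _ => hvσ m)
    (fun m hm => by rw [hwm]; exact (Finset.mem_filter.1 hm).2)
    (show 0 < ε ^ 2 / 32 by positivity) hgood
  refine ⟨A, B, hA, fun y => (hB y).trans (le_of_eq ?_), hAB⟩
  field_simp
  ring

end Core

section Local

variable {F : ℕ → Type*} [∀ i, NormedAddCommGroup (F i)] [∀ i, InnerProductSpace ℝ (F i)]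
  [∀ i, FiniteDimensional ℝ (F i)] {T : lp F 1 →L[ℝ] lp F 1}

/-- The identities of all Euclidean spaces factor uniformly through an operator which is not
approximable by operators with an `ℓ¹`-series. -/
lemma exists_uniform_identity_factor (hT : ∀ x, ‖T x‖ ≤ ‖x‖) {ε : ℝ} (hε : 0 < ε)
    (hfar : ∀ (K : ℝ) (U : lp F 1 →L[ℝ] lp F 1), EllOneSeries ℕ K U → ε < ‖T - U‖) :
    ∃ C : ℝ, 0 < C ∧ ∀ k, ∃ (A : EuclideanSpace ℝ (Fin k) →L[ℝ] lp F 1)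
      (B : lp F 1 →L[ℝ] EuclideanSpace ℝ (Fin k)),
      (∀ c, ‖A c‖ ≤ C * ‖c‖) ∧ (∀ y, ‖B y‖ ≤ C * ‖y‖) ∧ ∀ c, B (T (A c)) = c := by
  classical
  have := fun i => FiniteDimensional.complete ℝ (F i)
  refine ⟨2 + 64 / (ε / 4) ^ 2, by positivity, fun k => ?_⟩
  obtain ⟨L, hL⟩ := exists_nat_gt (18 * (k : ℝ) ^ 2 + 18 * (k : ℝ) ^ 2 * 128 / (ε / 4) ^ 2)
  have hpos : (0 : ℝ) ≤ 18 * (k : ℝ) ^ 2 * 128 / (ε / 4) ^ 2 := by positivity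
  have hpos' : (0 : ℝ) ≤ 18 * (k : ℝ) ^ 2 := by positivity
  have hL0 : 0 < L := by
    have : (0 : ℝ) < L := by linarith
    exact_mod_cast this
  have hL1 : 18 * (k : ℝ) ^ 2 ≤ L := by linarith
  have hL2 : 18 * (k : ℝ) ^ 2 * 128 ≤ (ε / 4) ^ 2 * L := by
    rw [mul_comm _ (L : ℝ), ← div_le_iff₀ (by positivity)]
    linarith
  have hι : ∀ n (x : F n), ‖(lp.singleContinuousLinearMap ℝ F 1 n) x‖ = ‖x‖ := fun n x => by
    rw [lp.singleContinuousLinearMap_apply, lp.norm_single (by simp)]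
  have hTι : ∀ n (x : F n), ‖(T.comp (lp.singleContinuousLinearMap ℝ F 1 n)) x‖ ≤ ‖x‖ :=
    fun n x => (hT _).trans (hι n x).le
  have hex : ∃ n, ¬ ∃ U : F n →L[ℝ] lp F 1, EllOneSeries ℕ (2 * L) U ∧
      ∀ x, ‖(T.comp (lp.singleContinuousLinearMap ℝ F 1 n) - U) x‖ ≤ ε * ‖x‖ := by
    by_contra! hcon
    choose U hU hUε using hcon
    have h1 := EllOneSeries.lpOneSum (by positivity : (0 : ℝ) ≤ 2 * L) hU
    refine absurd (hfar _ _ h1) (not_lt.2 (ContinuousLinearMap.opNorm_le_bound _ hε.le ?_))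
    refine norm_le_of_single fun n x => ?_
    rw [sub_apply, lpOneSum_single]
    exact hUε n x
  obtain ⟨n, hn⟩ := hex
  obtain ⟨t, μ, z, hμ, hz, hU⟩ := exists_family_of_not_approx (hTι n) (by positivity) hε hn
  obtain ⟨A, B, hA, hB, hAB⟩ :=
    exists_identity_factor_of_far (hTι n) (by positivity) hL0 hL1 hL2 hz hμ.le hU
  have hpos2 : 0 ≤ 64 / (ε / 4) ^ 2 := by positivity
  refine ⟨(lp.singleContinuousLinearMap ℝ F 1 n).comp A, B, fun c => ?_, fun y => ?_, hAB⟩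
  · refine (hι n (A c)).le.trans ((hA c).trans ?_)
    gcongr
    linarith
  · refine (hB y).trans ?_
    gcongr
    linarith

lemma inner_euclSum {κ : Type*} [Fintype κ] {X : Type*} [NormedAddCommGroup X]
    [InnerProductSpace ℝ X] {e : κ → X} (he : Orthonormal ℝ e) (c d : EuclideanSpace ℝ κ) :
    ⟪euclSum e c, euclSum e d⟫ = ⟪c, d⟫ := by
  rw [euclSum_apply, euclSum_apply, he.inner_sum, PiLp.inner_apply]
  simp [mul_comm]

/-- One may moreover avoid finitely many coordinates. -/
lemma exists_identity_factor_of_vanishing {C : ℝ} (hT : ∀ k,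
    ∃ (A : EuclideanSpace ℝ (Fin k) →L[ℝ] lp F 1) (B : lp F 1 →L[ℝ] EuclideanSpace ℝ (Fin k)),
      (∀ c, ‖A c‖ ≤ C * ‖c‖) ∧ (∀ y, ‖B y‖ ≤ C * ‖y‖) ∧ ∀ c, B (T (A c)) = c) (n N : ℕ) :
    ∃ (A : EuclideanSpace ℝ (Fin n) →L[ℝ] lp F 1) (B : lp F 1 →L[ℝ] EuclideanSpace ℝ (Fin n)),
      (∀ c, ‖A c‖ ≤ C * ‖c‖) ∧ (∀ y, ‖B y‖ ≤ C * ‖y‖) ∧ (∀ c, B (T (A c)) = c) ∧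
        ∀ c, ∀ m < N, T (A c) m = 0 := by
  set d := Module.finrank ℝ (∀ m : Fin N, F m)
  obtain ⟨A, B, hA, hB, hAB⟩ := hT (n + d)
  set Λ : EuclideanSpace ℝ (Fin (n + d)) →ₗ[ℝ] (∀ m : Fin N, F m) :=
    LinearMap.pi fun m => ((lp.evalCLM ℝ F 1 m).comp (T.comp A) : _ →ₗ[ℝ] F m) with hΛ
  have hker : n ≤ Module.finrank ℝ (LinearMap.ker Λ) := by
    have h1 := Λ.finrank_range_add_finrank_ker
    have h2 : Module.finrank ℝ (LinearMap.range Λ) ≤ d := Submodule.finrank_le _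
    rw [finrank_euclideanSpace_fin] at h1
    omega
  set e : Fin n → EuclideanSpace ℝ (Fin (n + d)) := fun j =>
    ((stdOrthonormalBasis ℝ (LinearMap.ker Λ) (Fin.castLE hker j) : LinearMap.ker Λ) :
      EuclideanSpace ℝ (Fin (n + d))) with he
  have heo : Orthonormal ℝ e :=
    ((stdOrthonormalBasis ℝ (LinearMap.ker Λ)).orthonormal.comp _
      (Fin.castLE_injective hker)).comp_linearIsometry (LinearMap.ker Λ).subtypeₗᵢ
  have hJn : ∀ c, ‖euclSum e c‖ = ‖c‖ := fun c => by
    rw [norm_eq_sqrt_real_inner, inner_euclSum heo, ← norm_eq_sqrt_real_inner]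
  have hJk : ∀ c, euclSum e c ∈ LinearMap.ker Λ := fun c => by
    rw [euclSum_apply]
    exact Submodule.sum_mem _ fun j _ => Submodule.smul_mem _ _ (Subtype.coe_prop _)
  refine ⟨A.comp (euclSum e), (ContinuousLinearMap.adjoint (euclSum e)).comp B, fun c => ?_,
    fun y => ?_, fun c => ?_, fun c m hm => ?_⟩
  · exact (hA (euclSum e c)).trans (by rw [hJn])
  · have h1 : ‖ContinuousLinearMap.adjoint (euclSum e)‖ ≤ 1 := by
      rw [LinearIsometryEquiv.norm_map]
      exact ContinuousLinearMap.opNorm_le_bound _ zero_le_one fun c => by rw [hJn, one_mul]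
    refine (ContinuousLinearMap.le_of_opNorm_le _ h1 _).trans ?_
    rw [one_mul]
    exact hB y
  · refine ext_inner_left ℝ fun v => ?_
    change ⟪v, ContinuousLinearMap.adjoint (euclSum e) (B (T (A (euclSum e c))))⟫ = _
    rw [hAB, ContinuousLinearMap.adjoint_inner_right, inner_euclSum heo]
  · exact congrFun (LinearMap.mem_ker.1 (hJk c)) ⟨m, hm⟩

end Local

section Gluing

variable {F : ℕ → Type*} [∀ i, NormedAddCommGroup (F i)] [∀ i, NormedSpace ℝ (F i)]

/-- The restriction of the elements of an `ℓ¹`-sum to finitely many coordinates. -/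
def finTrunc (I : Finset ℕ) : lp F 1 →L[ℝ] lp F 1 :=
  ∑ m ∈ I, (lp.singleContinuousLinearMap ℝ F 1 m).comp (lp.evalCLM ℝ F 1 m)

lemma finTrunc_eq_sum (I : Finset ℕ) (y : lp F 1) :
    finTrunc I y = ∑ m ∈ I, lp.single 1 m (y m) := by
  simp only [finTrunc, sum_apply]
  rfl

lemma finTrunc_apply_of_mem {I : Finset ℕ} {m : ℕ} (hm : m ∈ I) (y : lp F 1) :
    finTrunc I y m = y m := by
  rw [finTrunc_eq_sum, lp.coeFn_sum, Finset.sum_apply, Finset.sum_eq_single m]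
  · exact lp.single_apply_self _ _ _
  · exact fun j _ hj => lp.single_apply_ne _ _ _ hj.symm
  · exact fun h => absurd hm h

lemma finTrunc_apply_of_notMem {I : Finset ℕ} {m : ℕ} (hm : m ∉ I) (y : lp F 1) :
    finTrunc I y m = 0 := by
  rw [finTrunc_eq_sum, lp.coeFn_sum, Finset.sum_apply]
  exact Finset.sum_eq_zero fun j hj => lp.single_apply_ne _ _ _ fun h => hm (h ▸ hj)

lemma norm_finTrunc_le (I : Finset ℕ) (y : lp F 1) : ‖finTrunc I y‖ ≤ ∑ m ∈ I, ‖y m‖ := by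
  rw [finTrunc_eq_sum]
  refine (norm_sum_le _ _).trans (Finset.sum_le_sum fun m _ => ?_)
  rw [lp.norm_single (by simp)]

lemma exists_norm_sub_finTrunc_le {V : Type*} [NormedAddCommGroup V] [InnerProductSpace ℝ V]
    [FiniteDimensional ℝ V] (S : V →L[ℝ] lp F 1) {η : ℝ} (hη : 0 < η) (N₀ : ℕ) :
    ∃ N, N₀ < N ∧ ∀ x, ‖S x - finTrunc (Finset.range N) (S x)‖ ≤ η * ‖x‖ := by
  set b := stdOrthonormalBasis ℝ V
  set d := Module.finrank ℝ V
  have h1 : ∀ j, ∀ᶠ N in atTop, ‖S (b j) - finTrunc (Finset.range N) (S (b j))‖ ≤ η / (d + 1) := by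
    intro j
    have h2 := (lp.hasSum_single (by simp) (S (b j))).tendsto_sum_nat
    simp only [← finTrunc_eq_sum] at h2
    have h3 := (h2.const_sub (S (b j))).norm
    rw [sub_self, norm_zero] at h3
    filter_upwards [h3.eventually (gt_mem_nhds (show (0 : ℝ) < η / (d + 1) by positivity))]
      with N hN using hN.le
  obtain ⟨N, hN, hN0⟩ := ((eventually_all.2 h1).and (eventually_gt_atTop N₀)).exists
  refine ⟨N, hN0, fun x => ?_⟩
  have h4 : S x - finTrunc (Finset.range N) (S x) =
      ∑ j, ⟪b j, x⟫ • (S (b j) - finTrunc (Finset.range N) (S (b j))) := by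
    conv_lhs => rw [← b.sum_repr' x]
    simp only [map_sum, map_smul, smul_sub, Finset.sum_sub_distrib]
  rw [h4]
  refine (norm_sum_le _ _).trans ?_
  refine (Finset.sum_le_sum (g := fun _ => ‖x‖ * (η / (d + 1))) fun j _ => ?_).trans ?_
  · rw [norm_smul]
    refine mul_le_mul ?_ (hN j) (norm_nonneg _) (norm_nonneg _)
    refine (norm_inner_le_norm _ _).trans ?_
    rw [b.norm_eq_one, one_mul]
  · rw [Finset.sum_const, Finset.card_univ, Fintype.card_fin, nsmul_eq_mul]
    have h5 : (d : ℝ) * (‖x‖ * (η / (d + 1))) = (d / (d + 1)) * (η * ‖x‖) := by ring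
    rw [h5]
    refine mul_le_of_le_one_left (by positivity) ?_
    rw [div_le_one (by positivity)]
    linarith

/-- Local factorizations with essentially disjoint ranges glue to a factorization of the
identity of the `ℓ¹`-sum. -/
lemma exists_factor_one {G : ℕ → Type*} [∀ i, NormedAddCommGroup (G i)]
    [∀ i, InnerProductSpace ℝ (G i)] [∀ i, FiniteDimensional ℝ (G i)]
    [∀ i, CompleteSpace (F i)] {X : Type*}
    [NormedAddCommGroup X] [NormedSpace ℝ X] [CompleteSpace X] {T : X →L[ℝ] lp F 1} {C : ℝ}
    (hC : 0 < C) (h : ∀ n N : ℕ, ∃ (A : G n →L[ℝ] X) (B : lp F 1 →L[ℝ] G n),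
      (∀ c, ‖A c‖ ≤ C * ‖c‖) ∧ (∀ y, ‖B y‖ ≤ C * ‖y‖) ∧ (∀ c, B (T (A c)) = c) ∧
        ∀ c, ∀ m < N, T (A c) m = 0) :
    ∃ (A : lp G 1 →L[ℝ] X) (B : lp F 1 →L[ℝ] lp G 1), B.comp (T.comp A) = 1 := by
  classical
  have := fun i => FiniteDimensional.complete ℝ (G i)
  choose A B hA hB hAB h0 using h
  have hη : 0 < 1 / (4 * C) := by positivity
  choose next hnext hnext_le using fun n N =>
    exists_norm_sub_finTrunc_le (T.comp (A n N)) hη N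
  set ν : ℕ → ℕ := fun n => Nat.rec 0 (fun n N => next n N) n
  have hνs : ∀ n, ν (n + 1) = next n (ν n) := fun n => rfl
  have hνm : StrictMono ν := strictMono_nat_of_lt_succ fun n => hnext n (ν n)
  set I : ℕ → Finset ℕ := fun n => Finset.Ico (ν n) (ν (n + 1))
  have hId : ∀ n n', n ≠ n' → Disjoint (I n) (I n') := by
    intro n n' hnn
    have := hνm.monotone.pairwise_disjoint_on_Ico_succ hnn
    rw [Function.onFun, ← Finset.coe_Ico, ← Finset.coe_Ico, Finset.disjoint_coe] at this
    exact this
  have htail : ∀ n x, ‖T (A n (ν n) x) - finTrunc (I n) (T (A n (ν n) x))‖ ≤ 1 / (4 * C) * ‖x‖ := by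
    intro n x
    have h1 : finTrunc (I n) (T (A n (ν n) x)) =
        finTrunc (Finset.range (ν (n + 1))) (T (A n (ν n) x)) := by
      ext m
      by_cases hm : m ∈ I n
      · rw [finTrunc_apply_of_mem hm, finTrunc_apply_of_mem (by
          simpa using (Finset.mem_Ico.1 hm).2)]
      · rw [finTrunc_apply_of_notMem hm]
        by_cases hm' : m < ν (n + 1)
        · rw [finTrunc_apply_of_mem (by simpa using hm')]
          refine (h0 n (ν n) x m ?_).symm
          by_contra hlt
          exact hm (Finset.mem_Ico.2 ⟨not_lt.1 hlt, hm'⟩)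
        · rw [finTrunc_apply_of_notMem (by simpa using hm')]
    rw [h1, hνs]
    exact hnext_le n (ν n) x
  set A' : lp G 1 →L[ℝ] X := lpOneSum (fun n => A n (ν n)) C fun n => hA n (ν n) with hA'
  set B' : lp F 1 →L[ℝ] lp G 1 := lpOneMk (fun n => (B n (ν n)).comp (finTrunc (I n))) C
    (fun y s => by
      refine (Finset.sum_le_sum (g := fun n => C * ∑ m ∈ I n, ‖y m‖) fun n _ => ?_).trans ?_
      · refine (hB n (ν n) _).trans ?_
        gcongr
        exact norm_finTrunc_le _ _
      · rw [← Finset.mul_sum, ← Finset.sum_biUnion fun n _ n' _ hnn => hId n n' hnn]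
        gcongr
        exact lpOne_sum_norm_le y _) with hB'
  have hB'le : ∀ y, ‖B' y‖ ≤ C * ‖y‖ := norm_lpOneMk_le _ _ _
  have hB'tr : ∀ n y, B' (finTrunc (I n) y) = lp.single 1 n (B n (ν n) (finTrunc (I n) y)) := by
    intro n y
    ext n'
    change B n' (ν n') (finTrunc (I n') (finTrunc (I n) y)) = _
    rcases eq_or_ne n' n with rfl | hne
    · rw [lp.single_apply_self]
      congr 1
      ext m
      by_cases hm : m ∈ I n'
      · rw [finTrunc_apply_of_mem hm]
      · rw [finTrunc_apply_of_notMem hm, finTrunc_apply_of_notMem hm]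
    · rw [lp.single_apply_ne _ _ _ hne]
      have : finTrunc (I n') (finTrunc (I n) y) = 0 := by
        ext m
        by_cases hm : m ∈ I n'
        · rw [finTrunc_apply_of_mem hm,
            finTrunc_apply_of_notMem (Finset.disjoint_left.1 (hId n' n hne) hm)]
          rfl
        · rw [finTrunc_apply_of_notMem hm]
          rfl
      rw [this, map_zero]
  set Vop : lp G 1 →L[ℝ] lp G 1 := B'.comp (T.comp A')
  have hV1 : ‖1 - Vop‖ ≤ 1 / 2 := by
    refine ContinuousLinearMap.opNorm_le_bound _ (by norm_num) (norm_le_of_single fun n x => ?_)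
    set y := T (A n (ν n) x) with hy
    set y' := y - finTrunc (I n) y with hy'
    have h1 : Vop (lp.single 1 n x) = B' y := by
      change B' (T (A' (lp.single 1 n x))) = _
      rw [hA', lpOneSum_single]
    have h2 : (1 - Vop) (lp.single 1 n x) = lp.single 1 n (B n (ν n) y') - B' y' := by
      have h3 : B n (ν n) (finTrunc (I n) y) = x - B n (ν n) y' := by
        rw [hy', map_sub, hy, hAB]
        abel
      have h4 : B' y = B' (finTrunc (I n) y) + B' y' := by rw [← map_add, hy']; abel_nf
      rw [sub_apply, h1, h4, hB'tr, h3, lp.single_sub]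
      change lp.single 1 n x - _ = _
      abel
    rw [h2]
    refine (norm_sub_le _ _).trans ?_
    rw [lp.norm_single (by simp)]
    have h5 := mul_le_mul_of_nonneg_left (htail n x) hC.le
    have h6 : C * (1 / (4 * C) * ‖x‖) = 1 / 4 * ‖x‖ := by field_simp
    have h7 := hB n (ν n) y'
    have h8 := hB'le y'
    rw [h6] at h5
    change C * ‖y'‖ ≤ _ at h5
    linarith
  have hu : IsUnit Vop := by
    have := isUnit_one_sub_of_norm_lt_one (x := 1 - Vop) (by linarith)
    rwa [sub_sub_cancel] at this
  obtain ⟨u, hu⟩ := hu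
  refine ⟨A', (↑u⁻¹ : lp G 1 →L[ℝ] lp G 1).comp B', ?_⟩
  have := u.inv_mul
  rw [hu] at this
  exact this

end Gluing

section Trace

lemma EllOneSeries.comp_of_contractions {W X Y Z : Type*} [NormedAddCommGroup W] [NormedSpace ℝ W]
    [NormedAddCommGroup X] [NormedSpace ℝ X] [NormedAddCommGroup Y] [NormedSpace ℝ Y]
    [NormedAddCommGroup Z] [NormedSpace ℝ Z] {K : ℝ} (hK : 0 ≤ K) {U : X →L[ℝ] Y}
    (h : EllOneSeries ℕ K U) {P : W →L[ℝ] X} (hP : ∀ x, ‖P x‖ ≤ ‖x‖) {Q : Y →L[ℝ] Z}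
    (hQ : ∀ y, ‖Q y‖ ≤ ‖y‖) : EllOneSeries ℕ K (Q.comp (U.comp P)) := by
  obtain ⟨r, s, hs, hr, hU⟩ := h
  refine ⟨fun i => (r i).comp P, fun i => Q (s i), fun i => (hQ _).trans (hs i), fun x t => ?_,
    fun x => ?_⟩
  · refine (hr (P x) t).trans ?_
    gcongr
    exact hP x
  · simpa using (hU (P x)).mapL Q

lemma EllOneSeries.trace_le {V κ : Type*} [NormedAddCommGroup V] [InnerProductSpace ℝ V]
    [Fintype κ] [Nonempty κ] {K : ℝ} (hK : 0 ≤ K) {U : V →L[ℝ] V} (h : EllOneSeries ℕ K U)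
    {b : κ → V} (hb : Orthonormal ℝ b) :
    ∑ j, ⟪b j, U (b j)⟫ ≤ 2 * K * √(Fintype.card κ) := by
  classical
  obtain ⟨r, s, hs, hr, hU⟩ := h
  have hsum : HasSum (fun i => ∑ j, r i (b j) * ⟪b j, s i⟫) (∑ j, ⟪b j, U (b j)⟫) :=
    hasSum_sum fun j _ => by
      simpa [real_inner_smul_right] using (hU (b j)).mapL (innerSL ℝ (b j))
  refine le_of_tendsto hsum (Filter.Eventually.of_forall fun t => ?_)
  set a := √(Fintype.card κ : ℝ)
  have hcard : (0 : ℝ) < Fintype.card κ := by exact_mod_cast Fintype.card_pos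
  have ha0 : 0 < a := Real.sqrt_pos.2 hcard
  have ha2 : a ^ 2 = Fintype.card κ := Real.sq_sqrt hcard.le
  have h1 : ∀ i, ∑ j, r i (b j) * ⟪b j, s i⟫ ≤
      2 * Finset.expect Finset.univ fun ω : κ → Bool => ‖r i (radSum id ω Finset.univ b)‖ := by
    intro i
    have h2 := sqrt_sum_le_expect_norm_radSum (e := (id : κ → κ)) Function.injective_id
      (fun j => r i (b j)) Finset.univ
    simp only [← map_radSum (r i)] at h2
    refine le_trans ?_ h2
    refine Real.le_sqrt_of_sq_le ((Finset.sum_mul_sq_le_sq_mul_sq _ _ _).trans ?_)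
    simp only [Real.norm_eq_abs, sq_abs]
    refine mul_le_of_le_one_right (by positivity) ?_
    have h3 := hb.sum_inner_products_le (s i) (s := Finset.univ)
    simp only [Real.norm_eq_abs, sq_abs] at h3
    refine h3.trans ?_
    have := hs i
    have := norm_nonneg (s i)
    nlinarith
  refine (Finset.sum_le_sum fun i _ => h1 i).trans ?_
  rw [← Finset.mul_sum, ← Finset.expect_sum_comm, mul_assoc]
  refine mul_le_mul_of_nonneg_left ?_ zero_le_two
  have h4 : ∀ ω : κ → Bool, ∑ i ∈ t, ‖r i (radSum id ω Finset.univ b)‖ ≤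
      K * (a / 2) + K / (2 * a) * ‖radSum id ω Finset.univ b‖ ^ 2 := fun ω => by
    refine (hr _ t).trans ?_
    have h5 : ‖radSum id ω Finset.univ b‖ ≤ a / 2 + 1 / (2 * a) * ‖radSum id ω Finset.univ b‖ ^ 2 := by
      rw [← sub_nonneg]
      have : a / 2 + 1 / (2 * a) * ‖radSum id ω Finset.univ b‖ ^ 2 -
          ‖radSum id ω Finset.univ b‖ = (a - ‖radSum id ω Finset.univ b‖) ^ 2 / (2 * a) := by
        field_simp
        ring
      rw [this]
      positivity
    refine (mul_le_mul_of_nonneg_left h5 hK).trans (le_of_eq ?_)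
    ring
  refine (Finset.expect_le_expect fun ω _ => h4 ω).trans ?_
  rw [Finset.expect_add_distrib, Fintype.expect_const, ← Finset.mul_expect,
    expect_norm_sq_radSum_const Function.injective_id]
  simp only [hb.1, one_pow, Finset.sum_const, Finset.card_univ, nsmul_eq_mul, mul_one]
  rw [← ha2]
  apply le_of_eq
  field_simp
  ring

end Trace

section Ideal

lemma one_notMem_closGEllOne : (1 : E2Space →L[ℝ] E2Space) ∉ closGEllOne := by
  intro h1
  obtain ⟨U, ⟨R, S, rfl⟩, hU⟩ := Metric.mem_closure_iff.1 h1 (1 / 2) (by norm_num)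
  rw [dist_eq_norm] at hU
  obtain ⟨K', hK'⟩ := exists_ellOneSeries_comp R S
  set K := max K' 0
  have hK0 : 0 ≤ K := le_max_right _ _
  have hK : EllOneSeries ℕ K (S.comp R) := hK'.mono (le_max_left _ _)
  obtain ⟨n, hn⟩ := exists_nat_gt ((4 * K) ^ 2)
  set P := lp.singleContinuousLinearMap ℝ (fun n : ℕ => EuclideanSpace ℝ (Fin (n + 1))) 1 n
  set Q := lp.evalCLM ℝ (fun n : ℕ => EuclideanSpace ℝ (Fin (n + 1))) 1 n
  have hP : ∀ x, ‖P x‖ ≤ ‖x‖ := fun x => by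
    rw [lp.singleContinuousLinearMap_apply, lp.norm_single (by simp)]
  have hQ : ∀ y, ‖Q y‖ ≤ ‖y‖ := fun y => by
    have := lpOne_sum_norm_le y {n}
    rwa [Finset.sum_singleton] at this
  have hPQ : ∀ x, Q (P x) = x := fun x =>
    lp.single_apply_self (E := fun n : ℕ => EuclideanSpace ℝ (Fin (n + 1))) 1 n x
  set b := EuclideanSpace.basisFun (Fin (n + 1)) ℝ
  have htr := (hK.comp_of_contractions hK0 hP hQ).trace_le hK0 b.orthonormal
  have hle : ∀ j, 1 / 2 ≤ ⟪b j, (Q.comp ((S.comp R).comp P)) (b j)⟫ := by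
    intro j
    have hbj : ‖b j‖ = 1 := b.norm_eq_one j
    have h2 : ⟪b j, b j - (Q.comp ((S.comp R).comp P)) (b j)⟫ ≤ 1 / 2 := by
      have h3 : b j - (Q.comp ((S.comp R).comp P)) (b j) = Q ((1 - S.comp R) (P (b j))) := by
        rw [sub_apply, map_sub, one_apply_eq_self, hPQ]
        rfl
      rw [h3]
      refine (real_inner_le_norm _ _).trans ?_
      rw [hbj, one_mul]
      refine (hQ _).trans ((ContinuousLinearMap.le_of_opNorm_le _ hU.le _).trans ?_)
      have := hP (b j)
      rw [hbj] at this
      linarith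
    rw [inner_sub_right, real_inner_self_eq_norm_sq, hbj] at h2
    linarith
  have hsum := (Finset.sum_le_sum fun j (_ : j ∈ Finset.univ) => hle j).trans htr
  rw [Finset.sum_const, Finset.card_univ, Fintype.card_fin, nsmul_eq_mul] at hsum
  have hs := Real.sq_sqrt (show (0 : ℝ) ≤ ((n + 1 : ℕ) : ℝ) by positivity)
  set q := √((n + 1 : ℕ) : ℝ)
  rw [← hs] at hsum
  have hq : q ≤ 4 * K := by
    by_contra hlt
    push Not at hlt
    nlinarith
  have : q ^ 2 ≤ (4 * K) ^ 2 := by gcongr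
  rw [hs] at this
  push_cast at this
  linarith

lemma mem_closGEllOne_of_ellOneSeries {K : ℝ} {U : E2Space →L[ℝ] E2Space}
    (h : EllOneSeries ℕ K U) : U ∈ closGEllOne :=
  subset_closure h.exists_factor

lemma zero_mem_closGEllOne : (0 : E2Space →L[ℝ] E2Space) ∈ closGEllOne :=
  mem_closGEllOne_of_ellOneSeries EllOneSeries.zero

lemma add_mem_closGEllOne {U V : E2Space →L[ℝ] E2Space} (hU : U ∈ closGEllOne)
    (hV : V ∈ closGEllOne) : U + V ∈ closGEllOne := by
  refine map_mem_closure₂ continuous_add hU hV ?_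
  rintro _ ⟨R, S, rfl⟩ _ ⟨R', S', rfl⟩
  obtain ⟨K, hK⟩ := exists_ellOneSeries_comp R S
  obtain ⟨K', hK'⟩ := exists_ellOneSeries_comp R' S'
  exact (hK.add hK').exists_factor

lemma mul_mem_closGEllOne_left (V : E2Space →L[ℝ] E2Space) {U : E2Space →L[ℝ] E2Space}
    (hU : U ∈ closGEllOne) : V * U ∈ closGEllOne := by
  refine map_mem_closure (continuous_const_mul V) hU ?_
  rintro _ ⟨R, S, rfl⟩
  exact ⟨R, V.comp S, rfl⟩

lemma mul_mem_closGEllOne_right {U : E2Space →L[ℝ] E2Space} (hU : U ∈ closGEllOne)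
    (V : E2Space →L[ℝ] E2Space) : U * V ∈ closGEllOne := by
  refine map_mem_closure (f := fun W => W * V) (continuous_mul_const V) hU ?_
  rintro _ ⟨R, S, rfl⟩
  exact ⟨R.comp V, S, rfl⟩

lemma exists_one_eq_mul_of_notMem {T : E2Space →L[ℝ] E2Space} (hT : T ∉ closGEllOne) :
    ∃ A B : E2Space →L[ℝ] E2Space, B * (T * A) = 1 := by
  have hT0 : 0 < ‖T‖ := norm_pos_iff.2 fun h => hT (h ▸ zero_mem_closGEllOne)
  have hfar : ∃ ε > 0, ∀ (K : ℝ) (U : E2Space →L[ℝ] E2Space), EllOneSeries ℕ K U →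
      ε ≤ ‖T - U‖ := by
    by_contra! hcon
    refine hT (Metric.mem_closure_iff.2 fun ε hε => ?_)
    obtain ⟨K, U, hU, hlt⟩ := hcon ε hε
    exact ⟨U, hU.exists_factor, by rwa [dist_eq_norm]⟩
  obtain ⟨ε, hε, hfar⟩ := hfar
  set T' := ‖T‖⁻¹ • T with hT'
  have hT'le : ∀ x, ‖T' x‖ ≤ ‖x‖ := fun x => by
    rw [hT', smul_apply, norm_smul, norm_inv, norm_norm, inv_mul_le_iff₀ hT0]
    exact T.le_opNorm x
  have hfar' : ∀ (K : ℝ) (U : E2Space →L[ℝ] E2Space), EllOneSeries ℕ K U →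
      ‖T‖⁻¹ * ε / 2 < ‖T' - U‖ := by
    intro K U hU
    have h1 := hfar _ _ (hU.smul ‖T‖)
    have h2 : T' - U = ‖T‖⁻¹ • (T - ‖T‖ • U) := by
      rw [smul_sub, smul_smul, inv_mul_cancel₀ hT0.ne', one_smul]
    rw [h2, norm_smul, norm_inv, norm_norm]
    have h3 : 0 < ‖T‖⁻¹ := inv_pos.2 hT0
    have h4 := mul_le_mul_of_nonneg_left h1 h3.le
    have h5 := mul_pos h3 hε
    linarith
  obtain ⟨C, hC, hloc⟩ := exists_uniform_identity_factor hT'le (by positivity) hfar'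
  obtain ⟨A, B, hAB⟩ := exists_factor_one (T := T') hC fun n N =>
    exists_identity_factor_of_vanishing hloc (n + 1) N
  refine ⟨‖T‖⁻¹ • A, B, ?_⟩
  rw [mul_smul_comm, ← smul_mul_assoc]
  exact hAB

end Ideal

/-- for `E = (⊕ₙ ℓ²(n))_{ℓ¹}`, the operator-norm closure of `G_{ℓ¹}(E)` is
the unique maximal two-sided ideal of `L(E)`: it is a proper closed two-sided ideal, and
every proper two-sided ideal of `L(E)` is contained in it. -/
theorem stmt10 :
    IsClosed closGEllOne ∧ closGEllOne ≠ Set.univ ∧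
      (∃ I : TwoSidedIdeal (E2Space →L[ℝ] E2Space),
        (I : Set (E2Space →L[ℝ] E2Space)) = closGEllOne) ∧
      ∀ J : TwoSidedIdeal (E2Space →L[ℝ] E2Space),
        (J : Set (E2Space →L[ℝ] E2Space)) ≠ Set.univ →
        (J : Set (E2Space →L[ℝ] E2Space)) ⊆ closGEllOne := by
  refine ⟨isClosed_closure, fun h => one_notMem_closGEllOne (h ▸ Set.mem_univ _),
    ⟨TwoSidedIdeal.mk' closGEllOne zero_mem_closGEllOne add_mem_closGEllOne
      (fun {U} hU => by simpa using mul_mem_closGEllOne_left (-1) hU)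
      (fun {V U} hU => mul_mem_closGEllOne_left V hU)
      (fun {U V} hU => mul_mem_closGEllOne_right hU V), ?_⟩, fun J hJ T hTJ => ?_⟩
  · ext U
    exact TwoSidedIdeal.mem_mk' _ _ _ _ _ _ _
  · by_contra hT
    obtain ⟨A, B, hAB⟩ := exists_one_eq_mul_of_notMem hT
    refine hJ (Set.eq_univ_of_forall fun V => ?_)
    have h1 : (1 : E2Space →L[ℝ] E2Space) ∈ J :=
      hAB ▸ J.mul_mem_left B _ (J.mul_mem_right T A hTJ)
    have h2 := J.mul_mem_left V 1 h1
    rwa [mul_one] at h2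
end
end

section
/- For every finite-dimensional Banach space G there is a constant K < ∞ such that for every Banach space X and every bounded linear operator T : X → G there exist bounded linear operators R : X → ℓ¹ and S : ℓ¹ → G with T = SR and ‖S‖·‖R‖ ≤ K‖T‖. In particular, for any ε > 0 and C < ∞, sup{Fac^ε_{ℓ¹}(T) : T ∈ L(X,G), X a Banach space, ‖T‖ ≤ C} < ∞. -/
open Filter Topology
open scoped ENNReal

noncomputable section

/-- `Fac^ε_Z(T) = inf {‖R‖·‖S‖ : ‖T - S ∘ R‖ ≤ ε}`, valued in `ℝ≥0∞` (the infimum of the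
empty set being `∞`). -/
def Fac (Z : Type*) [NormedAddCommGroup Z] [NormedSpace ℝ Z]
    {X Y : Type*} [NormedAddCommGroup X] [NormedSpace ℝ X]
    [NormedAddCommGroup Y] [NormedSpace ℝ Y] (ε : ℝ) (T : X →L[ℝ] Y) : ℝ≥0∞ :=
  sInf {c : ℝ≥0∞ | ∃ (R : X →L[ℝ] Z) (S : Z →L[ℝ] Y),
    ‖T - S.comp R‖ ≤ ε ∧ c = ENNReal.ofReal (‖R‖ * ‖S‖)}

/-- The identity of a finite-dimensional normed space factors through `ℓ¹`. -/
theorem exists_comp_eq_id_ellOne (G : Type*) [NormedAddCommGroup G] [NormedSpace ℝ G]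
    [FiniteDimensional ℝ G] :
    ∃ (A : G →L[ℝ] ellOne) (B : ellOne →L[ℝ] G), B.comp A = ContinuousLinearMap.id ℝ G := by
  let b := Module.finBasis ℝ G
  let A : G →ₗ[ℝ] ellOne := ∑ i, (b.coord i).smulRight (lp.single 1 (i : ℕ) (1 : ℝ))
  let B : ellOne →L[ℝ] G :=
    ∑ i : Fin (Module.finrank ℝ G), (lp.evalCLM ℝ (fun _ : ℕ => ℝ) 1 (i : ℕ)).smulRight (b i)
  refine ⟨LinearMap.toContinuousLinearMap A, B, ?_⟩
  have h (g : G) (i : Fin (Module.finrank ℝ G)) :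
      lp.evalCLM ℝ (fun _ : ℕ => ℝ) 1 (i : ℕ) (A g) = b.repr g i := by
    simp [A, LinearMap.sum_apply, map_sum, lp.evalCLM, Pi.single_apply, Fin.val_inj]
  ext g
  simp only [B, ContinuousLinearMap.comp_apply, LinearMap.coe_toContinuousLinearMap',
    sum_apply, ContinuousLinearMap.smulRight_apply, h]
  exact b.sum_repr g

/-- A factorization of the identity of `G` through `Z` induces, for every operator `T` into `G`,
a factorization through `Z` with norms controlled by `‖T‖`. -/
theorem factor_of_comp_eq_id {X Z G : Type*} [NormedAddCommGroup X] [NormedSpace ℝ X]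
    [NormedAddCommGroup Z] [NormedSpace ℝ Z] [NormedAddCommGroup G] [NormedSpace ℝ G]
    {A : G →L[ℝ] Z} {B : Z →L[ℝ] G} (hBA : B.comp A = ContinuousLinearMap.id ℝ G)
    (T : X →L[ℝ] G) :
    T = B.comp (A.comp T) ∧ ‖A.comp T‖ * ‖B‖ ≤ ‖B‖ * ‖A‖ * ‖T‖ := by
  refine ⟨by rw [← ContinuousLinearMap.comp_assoc, hBA, ContinuousLinearMap.id_comp], ?_⟩
  rw [mul_comm, mul_assoc]
  gcongr
  exact A.opNorm_comp_le T

/-- for every finite-dimensional Banach space `G` there is `K < ∞` such that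
every operator `T : X → G` from a Banach space `X` factors exactly through `ℓ¹` with
`‖S‖·‖R‖ ≤ K·‖T‖`.  In particular, for every `ε > 0` and `C < ∞`, the quantities
`Fac^ε_{ℓ¹}(T)` for `‖T‖ ≤ C` are uniformly bounded. -/
theorem stmt12 (G : Type*) [NormedAddCommGroup G] [NormedSpace ℝ G]
    [FiniteDimensional ℝ G] :
    (∃ K : ℝ, ∀ (X : Type*) [NormedAddCommGroup X] [NormedSpace ℝ X] [CompleteSpace X],
        ∀ T : X →L[ℝ] G, ∃ (R : X →L[ℝ] ellOne) (S : ellOne →L[ℝ] G),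
          T = S.comp R ∧ ‖S‖ * ‖R‖ ≤ K * ‖T‖) ∧
      ∀ ε : ℝ, 0 < ε → ∀ C : ℝ, ∃ M : ℝ≥0∞, M < ⊤ ∧
        ∀ (X : Type*) [NormedAddCommGroup X] [NormedSpace ℝ X] [CompleteSpace X],
          ∀ T : X →L[ℝ] G, ‖T‖ ≤ C → Fac ellOne ε T ≤ M := by
  obtain ⟨A, B, hBA⟩ := exists_comp_eq_id_ellOne G
  refine ⟨⟨‖B‖ * ‖A‖, fun X _ _ _ T => ⟨A.comp T, B, (factor_of_comp_eq_id hBA T).1, ?_⟩⟩,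
    fun ε hε C => ⟨ENNReal.ofReal (‖B‖ * ‖A‖ * C), ENNReal.ofReal_lt_top,
      fun X _ _ _ T hT => ?_⟩⟩
  · rw [mul_comm]
    exact (factor_of_comp_eq_id hBA T).2
  · refine le_trans (sInf_le ⟨A.comp T, B, ?_, rfl⟩) (ENNReal.ofReal_le_ofReal ?_)
    · rw [← (factor_of_comp_eq_id hBA T).1, sub_self, norm_zero]
      exact hε.le
    · exact (factor_of_comp_eq_id hBA T).2.trans (by gcongr)
end
end

section
/- Let (E_n) be a sequence of finite-dimensional Banach spaces satisfying condition (*), and let (W_j) be a sequence of bounded linear operators between Banach spaces. If some subsequence (1_{E_{n_k}})_k of the identity operators factors through (W_j) uniformly, then the full sequence (1_{E_n})_n factors through (W_j) uniformly. -/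
open Filter Topology
open scoped ENNReal

noncomputable section

/-- `(U n)` factor through `(V n)` uniformly: there is `K < ∞` such that each `U n` can be
written as `U n = R ∘ V k ∘ S` with `‖R‖·‖S‖ ≤ K`. -/
def FactorsUniformly {X Y G H : ℕ → Type*}
    [∀ n, NormedAddCommGroup (X n)] [∀ n, NormedSpace ℝ (X n)]
    [∀ n, NormedAddCommGroup (Y n)] [∀ n, NormedSpace ℝ (Y n)]
    [∀ n, NormedAddCommGroup (G n)] [∀ n, NormedSpace ℝ (G n)]
    [∀ n, NormedAddCommGroup (H n)] [∀ n, NormedSpace ℝ (H n)]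
    (U : ∀ n, X n →L[ℝ] Y n) (V : ∀ n, G n →L[ℝ] H n) : Prop :=
  ∃ K : ℝ, ∀ n, ∃ (k : ℕ) (S : X n →L[ℝ] G k) (R : H k →L[ℝ] Y n),
    U n = R.comp ((V k).comp S) ∧ ‖R‖ * ‖S‖ ≤ K

/-- let `(E n)` be finite-dimensional Banach spaces satisfying condition (*):
`(dim Eₙ)` is unbounded and there is `C < ∞` such that for all `m < n` there are
`i : Eₘ → Eₙ`, `q : Eₙ → Eₘ` with `q ∘ i = 1`, `‖i‖ ≤ 1`, `‖q‖ ≤ C`.  If some subsequence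
`(1_{E (n k)})` of the identities factors uniformly through a sequence `(W j)` of operators
between Banach spaces, then the full sequence `(1_{E m})` factors uniformly through
`(W j)`. -/
theorem stmt15 (E : ℕ → Type) [∀ n, NormedAddCommGroup (E n)] [∀ n, NormedSpace ℝ (E n)]
    [∀ n, FiniteDimensional ℝ (E n)]
    (hdim : ∀ k : ℕ, ∃ n, k ≤ Module.finrank ℝ (E n))
    (hstar : ∃ C : ℝ, ∀ m n : ℕ, m < n → ∃ (i : E m →L[ℝ] E n) (q : E n →L[ℝ] E m),
      q.comp i = ContinuousLinearMap.id ℝ (E m) ∧ ‖i‖ ≤ 1 ∧ ‖q‖ ≤ C)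
    (G H : ℕ → Type*)
    [∀ j, NormedAddCommGroup (G j)] [∀ j, NormedSpace ℝ (G j)] [∀ j, CompleteSpace (G j)]
    [∀ j, NormedAddCommGroup (H j)] [∀ j, NormedSpace ℝ (H j)] [∀ j, CompleteSpace (H j)]
    (W : ∀ j, G j →L[ℝ] H j)
    (n : ℕ → ℕ) (hn : StrictMono n)
    (h : FactorsUniformly (fun k => ContinuousLinearMap.id ℝ (E (n k))) W) :
    FactorsUniformly (fun m => ContinuousLinearMap.id ℝ (E m)) W := by
  obtain ⟨C, hC⟩ := hstar
  obtain ⟨K, hK⟩ := h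
  refine ⟨C * K, fun m => ?_⟩
  have hm : m < n (m + 1) := (Nat.lt_succ_self m).trans_le (hn.id_le (m + 1))
  obtain ⟨i, q, hqi, hi, hq⟩ := hC m (n (m + 1)) hm
  obtain ⟨k, S, R, hRS, hle⟩ := hK (m + 1)
  refine ⟨k, S.comp i, q.comp R, ?_, ?_⟩
  · ext x
    have hx : i x = R (W k (S (i x))) := DFunLike.congr_fun hRS (i x)
    have hq' : q (i x) = x := DFunLike.congr_fun hqi x
    change x = q (R (W k (S (i x))))
    rw [← hx, hq']
  · have hS : ‖S.comp i‖ ≤ ‖S‖ :=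
      (S.opNorm_comp_le i).trans (mul_le_of_le_one_right (norm_nonneg S) hi)
    have hR : ‖q.comp R‖ ≤ C * ‖R‖ :=
      (q.opNorm_comp_le R).trans (mul_le_mul_of_nonneg_right hq (norm_nonneg R))
    have hC0 : 0 ≤ C := (norm_nonneg q).trans hq
    calc ‖q.comp R‖ * ‖S.comp i‖ ≤ C * ‖R‖ * ‖S‖ := by gcongr
      _ = C * (‖R‖ * ‖S‖) := mul_assoc _ _ _
      _ ≤ C * K := by gcongr
end
end
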